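/- Let Γ_n be the directed graph of isomorphism classes of cubic graphs on 2n vertices connected by Whitehead moves, and let B_n ⊆ V(Γ_n) be the set of bridged cubic graphs. Then, provided d(B_n) ≥ d(V(Γ_n) ∖ B_n), the outer conductance of B_n satisfies φ_out(B_n) ≤ |B_n| / (3n · |V(Γ_n) ∖ B_n|); consequently φ_out(Γ_n) ≤ |B_n| / (3n · |V(Γ_n) ∖ B_n|) for all sufficiently large n. -/

import Mathlib

/-! Cubic multigraphs in the dart (half-edge) model, Whitehead moves,
and the "graph of graphs" `Γ_n`. -/

/-- A cubic multigraph on the `2 * n` vertices `Fin (2 * n)`, in the dart (half-edge) model: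
darts are `Fin (6 * n)`, `dinv` is the fixed-point-free involution exchanging the two darts of
each edge, and `vert` assigns to each dart its base vertex.  Loops and multiple edges are
allowed; `regular` says every vertex carries exactly three darts. -/
structure CubicGraph (n : ℕ) where
  vert : Fin (6 * n) → Fin (2 * n)
  dinv : Fin (6 * n) → Fin (6 * n)
  dinv_invol : ∀ d, dinv (dinv d) = d
  dinv_ne : ∀ d, dinv d ≠ d
  regular : ∀ v : Fin (2 * n), (Finset.univ.filter fun d => vert d = v).card = 3

namespace CubicGraph

variable {n : ℕ}

/-- Two darts are joined if they can be connected by a chain of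
"same vertex" / "other half of the same edge" steps. -/
def Reach (g : CubicGraph n) : Fin (6 * n) → Fin (6 * n) → Prop :=
  Relation.ReflTransGen fun a b => g.vert a = g.vert b ∨ g.dinv a = b

/-- Connectivity of a cubic multigraph. -/
def Connected (g : CubicGraph n) : Prop := ∀ d d', g.Reach d d'

/-- The edge of the dart `d` is a loop. -/
def IsLoop (g : CubicGraph n) (d : Fin (6 * n)) : Prop := g.vert (g.dinv d) = g.vert d

instance (g : CubicGraph n) (d : Fin (6 * n)) : Decidable (g.IsLoop d) :=
  inferInstanceAs (Decidable (_ = _))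

lemma card_filter_comp_swap (g : CubicGraph n) (q r : Fin (6 * n)) (v : Fin (2 * n)) :
    (Finset.univ.filter fun d => g.vert (Equiv.swap q r d) = v).card
      = (Finset.univ.filter fun d => g.vert d = v).card := by
  refine Finset.card_bij (fun d _ => Equiv.swap q r d) ?_ ?_ ?_
  · intro a ha
    simp only [Finset.mem_filter, Finset.mem_univ, true_and] at ha ⊢
    exact ha
  · intro a _ b _ h
    exact (Equiv.swap q r).injective h
  · intro b hb
    simp only [Finset.mem_filter, Finset.mem_univ, true_and] at hb
    exact ⟨Equiv.swap q r b, by simp [hb], by simp⟩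

/-- Exchange the base vertices of the two darts `q` and `r`, keeping everything else. -/
def swapDarts (g : CubicGraph n) (q r : Fin (6 * n)) : CubicGraph n where
  vert := fun d => g.vert (Equiv.swap q r d)
  dinv := g.dinv
  dinv_invol := g.dinv_invol
  dinv_ne := g.dinv_ne
  regular := fun v => (g.card_filter_comp_swap q r v).trans (g.regular v)

/-- The darts based at the same vertex as `x`, other than `x` itself. -/
def othersAt (g : CubicGraph n) (x : Fin (6 * n)) : Finset (Fin (6 * n)) :=
  (Finset.univ.filter fun d => g.vert d = g.vert x).erase x

lemma othersAt_nonempty (g : CubicGraph n) (x : Fin (6 * n)) :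
    (g.othersAt x).Nonempty := by
  have hx : x ∈ Finset.univ.filter fun d => g.vert d = g.vert x := by simp
  have h : (g.othersAt x).card = 2 := by
    rw [othersAt, Finset.card_erase_of_mem hx, g.regular]
  rw [← Finset.card_pos, h]
  norm_num

def oMin (g : CubicGraph n) (x : Fin (6 * n)) : Fin (6 * n) :=
  (g.othersAt x).min' (g.othersAt_nonempty x)

def oMax (g : CubicGraph n) (x : Fin (6 * n)) : Fin (6 * n) :=
  (g.othersAt x).max' (g.othersAt_nonempty x)

/-- The two Whitehead moves (indexed by `i : Fin 2`) performed on the edge containing the dart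
`x`.  On a loop the move leaves the graph unchanged; on a non-loop edge the two darts at the
endpoints of the edge other than the edge's own darts are re-attached in one of the two
possible new ways (realized by transporting one dart from each endpoint to the other). -/
def wh (g : CubicGraph n) (i : Fin 2) (x : Fin (6 * n)) : CubicGraph n :=
  if g.IsLoop x then g
  else if i = 0 then g.swapDarts (g.oMax x) (g.oMin (g.dinv x))
  else g.swapDarts (g.oMax x) (g.oMax (g.dinv x))

/-- An isomorphism of cubic multigraphs: a bijection of darts together with a compatible
bijection of vertices, commuting with the edge involutions. -/
structure Iso (g₁ g₂ : CubicGraph n) where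
  dartEquiv : Fin (6 * n) ≃ Fin (6 * n)
  vertEquiv : Fin (2 * n) ≃ Fin (2 * n)
  map_dinv : ∀ d, g₂.dinv (dartEquiv d) = dartEquiv (g₁.dinv d)
  map_vert : ∀ d, g₂.vert (dartEquiv d) = vertEquiv (g₁.vert d)

def IsIsomorphic (g₁ g₂ : CubicGraph n) : Prop := Nonempty (Iso g₁ g₂)

/-- Reachability avoiding the edge of the dart `x` (i.e. in the graph with that edge removed). -/
def ReachAvoiding (g : CubicGraph n) (x : Fin (6 * n)) :
    Fin (6 * n) → Fin (6 * n) → Prop :=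
  Relation.ReflTransGen fun a b =>
    g.vert a = g.vert b ∨ (g.dinv a = b ∧ a ≠ x ∧ a ≠ g.dinv x)

/-- The edge of `x` is a bridge: removing it disconnects the graph. -/
def IsBridge (g : CubicGraph n) (x : Fin (6 * n)) : Prop :=
  ¬ ∀ d d', g.ReachAvoiding x d d'

/-- A (connected) graph is bridged if it has at least one bridge. -/
def Bridged (g : CubicGraph n) : Prop := ∃ x, g.IsBridge x

/-- A graph is bridgeless if it has no bridge. -/
def Bridgeless (g : CubicGraph n) : Prop := ∀ x, ¬ g.IsBridge x

/-- `c` lists consecutive darts of a cycle of length `k`: the vertices visited are pairwise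
distinct, the end of each dart's edge is the base of the next one (cyclically), and the `k`
edges used are pairwise distinct. -/
def IsCycle (g : CubicGraph n) (k : ℕ) (c : Fin k → Fin (6 * n)) : Prop :=
  (∀ i : Fin k,
    g.vert (g.dinv (c i)) = g.vert (c ⟨(i.1 + 1) % k, Nat.mod_lt _ i.pos⟩)) ∧
  Function.Injective (fun i => g.vert (c i)) ∧
  ∀ i j : Fin k, c j ≠ g.dinv (c i)

/-- The cycle `c` is indecomposable (induced): no edge of `g` other than the cycle's own
edges joins two vertices of the cycle. -/
def Indecomposable (g : CubicGraph n) (k : ℕ) (c : Fin k → Fin (6 * n)) : Prop :=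
  ∀ d, (∃ i, g.vert d = g.vert (c i)) → (∃ j, g.vert (g.dinv d) = g.vert (c j)) →
    ∃ i, d = c i ∨ d = g.dinv (c i)

/-- The girth: the least length of a cycle. -/
noncomputable def girth (g : CubicGraph n) : ℕ :=
  sInf {k | 0 < k ∧ ∃ c : Fin k → Fin (6 * n), g.IsCycle k c}

/-- The only cycles of the graph are loops. -/
def OnlyLoopCycles (g : CubicGraph n) : Prop :=
  ∀ k, 2 ≤ k → ∀ c : Fin k → Fin (6 * n), ¬ g.IsCycle k c

/-- The number of darts lying on loops (each loop contributes two darts). -/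
def loopCount (g : CubicGraph n) : ℕ :=
  (Finset.univ.filter fun d => g.IsLoop d).card

end CubicGraph

instance {n : ℕ} : Finite (CubicGraph n) := by
  have hinj : Function.Injective fun g : CubicGraph n => (g.vert, g.dinv) := by
    rintro ⟨v₁, i₁, _, _, _⟩ ⟨v₂, i₂, _, _, _⟩ h
    simp only [Prod.mk.injEq] at h
    obtain ⟨h₁, h₂⟩ := h
    subst h₁; subst h₂; rfl
  exact Finite.of_injective _ hinj

/-- Isomorphism of connected cubic graphs. -/
def cgIso {n : ℕ} (g₁ g₂ : {g : CubicGraph n // g.Connected}) : Prop :=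
  CubicGraph.IsIsomorphic g₁.1 g₂.1

/-- The vertex set of the graph of graphs `Γ_n`: isomorphism classes of connected cubic
multigraphs on `2 * n` vertices. -/
abbrev GammaV (n : ℕ) := Quot (@cgIso n)

/-- The number of directed edges of `Γ_n` from the class `u` to the class `v`: one edge for
each Whitehead move of a representative of `u` whose result lies in the class `v`.  A move
specification is a pair `(i, x)` of a move type `i : Fin 2` and a dart `x`; each of the two
Whitehead moves of each edge is counted by exactly two specifications (one for each of the
two darts of the edge), whence the division by `2`. -/
noncomputable def edgeMult (n : ℕ) (u v : GammaV n) : ℕ :=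
  Nat.card {p : Fin 2 × Fin (6 * n) //
    CubicGraph.IsIsomorphic ((Quot.out u).1.wh p.1 p.2) (Quot.out v).1} / 2

/-- The sum of out-degrees of the classes in `S` (every class has out-degree `6 * n`:
two Whitehead moves for each of the `3 * n` edges). -/
noncomputable def dOut (n : ℕ) (S : Set (GammaV n)) : ℕ :=
  Nat.card {q : GammaV n × Fin 2 × Fin (6 * n) // q.1 ∈ S} / 2

/-- The number of directed edges of `Γ_n` from `S` to its complement. -/
noncomputable def boundaryCount (n : ℕ) (S : Set (GammaV n)) : ℕ :=
  Nat.card {q : GammaV n × Fin 2 × Fin (6 * n) // q.1 ∈ S ∧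
    ∀ v : GammaV n,
      CubicGraph.IsIsomorphic ((Quot.out q.1).1.wh q.2.1 q.2.2) (Quot.out v).1 → v ∉ S} / 2

/-- The outer conductance of a set `S` of vertices of `Γ_n`. -/
noncomputable def phiOutSet (n : ℕ) (S : Set (GammaV n)) : ℝ :=
  (boundaryCount n S : ℝ) / min (dOut n S : ℝ) (dOut n Sᶜ : ℝ)

/-- The outer conductance of `Γ_n`: the infimum of the outer conductances of nonempty
proper subsets of vertices. -/
noncomputable def phiOut (n : ℕ) : ℝ :=
  sInf {x : ℝ | ∃ S : Set (GammaV n), S.Nonempty ∧ Sᶜ.Nonempty ∧ x = phiOutSet n S}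

/-- The set of classes of bridged cubic graphs. -/
def bridgedSet (n : ℕ) : Set (GammaV n) := {u | (Quot.out u).1.Bridged}

namespace CubicGraph

variable {n : ℕ}

/-- A bijection of darts is an isomorphism of cubic graphs when it commutes with the edge
involutions and preserves the relation "based at the same vertex". -/
def IsDartIso (g₁ g₂ : CubicGraph n) (f : Equiv.Perm (Fin (6 * n))) : Prop :=
  (∀ d, g₂.dinv (f d) = f (g₁.dinv d)) ∧
    ∀ a b, g₁.vert a = g₁.vert b ↔ g₂.vert (f a) = g₂.vert (f b)

lemma exists_vert_eq (g : CubicGraph n) (v : Fin (2 * n)) : ∃ d, g.vert d = v := by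
  have h : 0 < (Finset.univ.filter fun d => g.vert d = v).card := by rw [g.regular]; norm_num
  obtain ⟨d, hd⟩ := Finset.card_pos.1 h
  exact ⟨d, by simpa using hd⟩

lemma IsDartIso.refl (g : CubicGraph n) : IsDartIso g g (Equiv.refl _) :=
  ⟨fun _ => rfl, fun _ _ => Iff.rfl⟩

lemma IsDartIso.symm {g₁ g₂ : CubicGraph n} {f : Equiv.Perm (Fin (6 * n))}
    (h : IsDartIso g₁ g₂ f) : IsDartIso g₂ g₁ f.symm := by
  refine ⟨fun d => ?_, fun a b => ?_⟩
  · rw [Equiv.eq_symm_apply, ← h.1, Equiv.apply_symm_apply]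
  · rw [h.2]; simp

lemma IsDartIso.trans {g₁ g₂ g₃ : CubicGraph n} {f f' : Equiv.Perm (Fin (6 * n))}
    (h : IsDartIso g₁ g₂ f) (h' : IsDartIso g₂ g₃ f') : IsDartIso g₁ g₃ (f.trans f') := by
  refine ⟨fun d => ?_, fun a b => ?_⟩
  · simp [h'.1, h.1]
  · simp [h.2 a b, h'.2 (f a)]

lemma isIsomorphic_iff {g₁ g₂ : CubicGraph n} :
    IsIsomorphic g₁ g₂ ↔ ∃ f, IsDartIso g₁ g₂ f := by
  constructor
  · rintro ⟨i⟩
    exact ⟨i.dartEquiv, i.map_dinv, fun a b => by simp [i.map_vert]⟩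
  · rintro ⟨f, hf⟩
    choose r₁ hr₁ using g₁.exists_vert_eq
    choose r₂ hr₂ using g₂.exists_vert_eq
    refine ⟨⟨f, ⟨fun v => g₂.vert (f (r₁ v)), fun v => g₁.vert (f.symm (r₂ v)), fun v => ?_,
      fun v => ?_⟩, hf.1, fun d => ?_⟩⟩
    · rw [← hr₁ v, hf.2]; simp [hr₂, hr₁]
    · rw [← hr₂ v, hf.symm.2]; simp [hr₂, hr₁]
    · simp [← hf.2, hr₁]

lemma IsIsomorphic.refl (g : CubicGraph n) : IsIsomorphic g g :=
  isIsomorphic_iff.2 ⟨_, IsDartIso.refl g⟩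

lemma IsIsomorphic.symm {g₁ g₂ : CubicGraph n} (h : IsIsomorphic g₁ g₂) : IsIsomorphic g₂ g₁ := by
  obtain ⟨f, hf⟩ := isIsomorphic_iff.1 h
  exact isIsomorphic_iff.2 ⟨_, hf.symm⟩

lemma IsIsomorphic.trans {g₁ g₂ g₃ : CubicGraph n} (h : IsIsomorphic g₁ g₂)
    (h' : IsIsomorphic g₂ g₃) : IsIsomorphic g₁ g₃ := by
  obtain ⟨f, hf⟩ := isIsomorphic_iff.1 h
  obtain ⟨f', hf'⟩ := isIsomorphic_iff.1 h'
  exact isIsomorphic_iff.2 ⟨_, hf.trans hf'⟩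

lemma IsDartIso.reachAvoiding {g₁ g₂ : CubicGraph n} {f : Equiv.Perm (Fin (6 * n))}
    (h : IsDartIso g₁ g₂ f) {x a b : Fin (6 * n)} (hab : g₁.ReachAvoiding x a b) :
    g₂.ReachAvoiding (f x) (f a) (f b) := by
  refine Relation.ReflTransGen.lift f ?_ _ _ hab
  rintro a b (hv | ⟨rfl, h1, h2⟩)
  · exact Or.inl ((h.2 _ _).1 hv)
  · exact Or.inr ⟨h.1 a, by simpa using h1, by simpa [h.1] using h2⟩

lemma IsDartIso.isBridge {g₁ g₂ : CubicGraph n} {f : Equiv.Perm (Fin (6 * n))}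
    (h : IsDartIso g₁ g₂ f) {x : Fin (6 * n)} (hx : g₁.IsBridge x) : g₂.IsBridge (f x) := by
  intro H
  refine hx fun a b => ?_
  simpa using h.symm.reachAvoiding (H (f a) (f b))

lemma IsIsomorphic.bridged {g₁ g₂ : CubicGraph n} (h : IsIsomorphic g₁ g₂) (hb : g₁.Bridged) :
    g₂.Bridged := by
  obtain ⟨f, hf⟩ := isIsomorphic_iff.1 h
  obtain ⟨x, hx⟩ := hb
  exact ⟨_, hf.isBridge hx⟩

lemma isIsomorphic_out (g : CubicGraph n) (hg : g.Connected) :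
    IsIsomorphic g (Quot.out (Quot.mk (@cgIso n) ⟨g, hg⟩)).1 := by
  have he : Equivalence (@cgIso n) :=
    ⟨fun g => IsIsomorphic.refl g.1, IsIsomorphic.symm, IsIsomorphic.trans⟩
  have := Quot.eqvGen_exact (Quot.out_eq (Quot.mk (@cgIso n) ⟨g, hg⟩))
  exact IsIsomorphic.symm (he.eqvGen_iff.1 this)

lemma gammaV_eq {u v : GammaV n} (h : IsIsomorphic (Quot.out u).1 (Quot.out v).1) : u = v := by
  rw [← Quot.out_eq u, ← Quot.out_eq v]
  exact Quot.sound h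

lemma mk_mem_bridgedSet {g : CubicGraph n} (hg : g.Connected) (hb : g.Bridged) :
    (Quot.mk (@cgIso n) ⟨g, hg⟩ : GammaV n) ∈ bridgedSet n :=
  (isIsomorphic_out g hg).bridged hb

lemma mk_notMem_bridgedSet {g : CubicGraph n} (hg : g.Connected) (hb : ¬ g.Bridged) :
    (Quot.mk (@cgIso n) ⟨g, hg⟩ : GammaV n) ∉ bridgedSet n :=
  fun h => hb ((isIsomorphic_out g hg).symm.bridged h)

lemma ReachAvoiding.symm {g : CubicGraph n} {x a b : Fin (6 * n)} (h : g.ReachAvoiding x a b) :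
    g.ReachAvoiding x b a := by
  refine (@Relation.ReflTransGen.stdSymm _ _ ⟨?_⟩).symm _ _ h
  rintro a b (hv | ⟨rfl, h1, h2⟩)
  · exact Or.inl hv.symm
  · refine Or.inr ⟨g.dinv_invol a, fun h => h2 ?_, fun h => h1 ?_⟩
    · rw [← h, g.dinv_invol]
    · rw [← g.dinv_invol a, h, g.dinv_invol]

lemma Reach.symm {g : CubicGraph n} {a b : Fin (6 * n)} (h : g.Reach a b) : g.Reach b a := by
  refine (@Relation.ReflTransGen.stdSymm _ _ ⟨?_⟩).symm _ _ h
  rintro a b (hv | rfl)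
  · exact Or.inl hv.symm
  · exact Or.inr (g.dinv_invol a)

lemma Reach.trans {g : CubicGraph n} {a b c : Fin (6 * n)} (h : g.Reach a b) (h' : g.Reach b c) :
    g.Reach a c := Relation.ReflTransGen.trans h h'

lemma ReachAvoiding.trans {g : CubicGraph n} {x a b c : Fin (6 * n)} (h : g.ReachAvoiding x a b)
    (h' : g.ReachAvoiding x b c) : g.ReachAvoiding x a c := Relation.ReflTransGen.trans h h'

lemma reach_of_vert_eq {g : CubicGraph n} {a b : Fin (6 * n)} (h : g.vert a = g.vert b) :
    g.Reach a b := Relation.ReflTransGen.single (Or.inl h)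

lemma reach_dinv (g : CubicGraph n) (a : Fin (6 * n)) : g.Reach a (g.dinv a) :=
  Relation.ReflTransGen.single (Or.inr rfl)

lemma reachAvoiding_of_vert_eq {g : CubicGraph n} {x a b : Fin (6 * n)}
    (h : g.vert a = g.vert b) : g.ReachAvoiding x a b := Relation.ReflTransGen.single (Or.inl h)

lemma reachAvoiding_dinv {g : CubicGraph n} {x a : Fin (6 * n)} (h1 : a ≠ x) (h2 : a ≠ g.dinv x) :
    g.ReachAvoiding x a (g.dinv a) := Relation.ReflTransGen.single (Or.inr ⟨rfl, h1, h2⟩)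

/-- In a bridgeless graph, or when `x` is not a bridge, all pairs avoid the edge of `x`. -/
lemma reach_of_reachAvoiding {g : CubicGraph n} {x a b : Fin (6 * n)}
    (h : g.ReachAvoiding x a b) : g.Reach a b := by
  refine Relation.ReflTransGen.mono ?_ _ _ h
  rintro a b (h | h)
  · exact Or.inl h
  · exact Or.inr h.1

lemma reachAvoiding_of_swapDarts {g : CubicGraph n} {q r x : Fin (6 * n)}
    (hqr : g.ReachAvoiding x q r) {a b : Fin (6 * n)}
    (hab : (g.swapDarts q r).ReachAvoiding x a b) : g.ReachAvoiding x a b := by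
  have hs : ∀ a, g.ReachAvoiding x a (Equiv.swap q r a) := by
    intro a
    rw [Equiv.swap_apply_def]
    split_ifs with h1 h2
    · exact h1 ▸ hqr
    · exact h2 ▸ hqr.symm
    · exact Relation.ReflTransGen.refl
  induction hab with
  | refl => exact Relation.ReflTransGen.refl
  | tail _ h ih =>
    refine ih.trans ?_
    rcases h with h | h
    · exact ((hs _).trans (reachAvoiding_of_vert_eq h)).trans (hs _).symm
    · exact Relation.ReflTransGen.single (Or.inr h)

lemma reach_of_swapDarts {g : CubicGraph n} {q r : Fin (6 * n)}
    (hqr : g.Reach q r) {a b : Fin (6 * n)}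
    (hab : (g.swapDarts q r).Reach a b) : g.Reach a b := by
  have hs : ∀ a, g.Reach a (Equiv.swap q r a) := by
    intro a
    rw [Equiv.swap_apply_def]
    split_ifs with h1 h2
    · exact h1 ▸ hqr
    · exact h2 ▸ hqr.symm
    · exact Relation.ReflTransGen.refl
  induction hab with
  | refl => exact Relation.ReflTransGen.refl
  | tail _ h ih =>
    refine ih.trans ?_
    rcases h with h | h
    · exact ((hs _).trans (reach_of_vert_eq h)).trans (hs _).symm
    · exact Relation.ReflTransGen.single (Or.inr h)

lemma swapDarts_swapDarts (g : CubicGraph n) (q r : Fin (6 * n)) :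
    (g.swapDarts q r).swapDarts q r = g := by
  cases g
  simp [swapDarts]

lemma connected_swapDarts {g : CubicGraph n} (hg : g.Connected) {q r x : Fin (6 * n)}
    (hx : ¬ g.IsLoop x) (hq : g.vert q = g.vert x) (hqx : q ≠ x)
    (hr : g.vert r = g.vert (g.dinv x)) (hrx : r ≠ g.dinv x) :
    (g.swapDarts q r).Connected := by
  intro a b
  have hx1 : Equiv.swap q r x = x := by
    refine Equiv.swap_apply_of_ne_of_ne hqx.symm ?_
    rintro rfl; exact hx hr.symm
  have hx2 : Equiv.swap q r (g.dinv x) = g.dinv x := by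
    refine Equiv.swap_apply_of_ne_of_ne ?_ hrx.symm
    rintro rfl; exact hx hq
  refine reach_of_swapDarts (q := q) (r := r) ?_ (by rw [swapDarts_swapDarts]; exact hg a b)
  have h1 : (g.swapDarts q r).vert q = (g.swapDarts q r).vert (g.dinv x) := by
    simp [swapDarts, hx2, hr]
  have h2 : (g.swapDarts q r).vert r = (g.swapDarts q r).vert x := by
    simp [swapDarts, hx1, hq]
  exact ((reach_of_vert_eq h1).trans (reach_dinv _ x).symm).trans (reach_of_vert_eq h2).symm

lemma oMax_mem (g : CubicGraph n) (x : Fin (6 * n)) : g.oMax x ∈ g.othersAt x :=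
  Finset.max'_mem _ _

lemma oMin_mem (g : CubicGraph n) (x : Fin (6 * n)) : g.oMin x ∈ g.othersAt x :=
  Finset.min'_mem _ _

lemma mem_othersAt {g : CubicGraph n} {x y : Fin (6 * n)} :
    y ∈ g.othersAt x ↔ y ≠ x ∧ g.vert y = g.vert x := by
  simp [othersAt]

lemma wh_eq_or (g : CubicGraph n) (i : Fin 2) (x : Fin (6 * n)) :
    g.wh i x = g ∨ (¬ g.IsLoop x ∧ ∃ q r, g.wh i x = g.swapDarts q r ∧
      q ≠ x ∧ g.vert q = g.vert x ∧ r ≠ g.dinv x ∧ g.vert r = g.vert (g.dinv x)) := by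
  unfold wh
  split_ifs with h1 h2
  · exact Or.inl rfl
  · have h3 := mem_othersAt.1 (g.oMax_mem x)
    have h4 := mem_othersAt.1 (g.oMin_mem (g.dinv x))
    exact Or.inr ⟨h1, _, _, rfl, h3.1, h3.2, h4.1, h4.2⟩
  · have h3 := mem_othersAt.1 (g.oMax_mem x)
    have h4 := mem_othersAt.1 (g.oMax_mem (g.dinv x))
    exact Or.inr ⟨h1, _, _, rfl, h3.1, h3.2, h4.1, h4.2⟩

lemma connected_wh {g : CubicGraph n} (hg : g.Connected) (i : Fin 2) (x : Fin (6 * n)) :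
    (g.wh i x).Connected := by
  obtain h | ⟨hl, q, r, h, h1, h2, h3, h4⟩ := g.wh_eq_or i x
  · rwa [h]
  · rw [h]; exact connected_swapDarts hg hl h2 h1 h4 h3

/-- A Whitehead move keeps every bridge other than the edge on which it is performed. -/
lemma isBridge_wh {g : CubicGraph n} {b : Fin (6 * n)} (hb : g.IsBridge b) (i : Fin 2)
    {x : Fin (6 * n)} (h1 : x ≠ b) (h2 : x ≠ g.dinv b) : (g.wh i x).IsBridge b := by
  obtain h | ⟨-, q, r, h, -, hq, -, hr⟩ := g.wh_eq_or i x
  · rwa [h]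
  · rw [h]
    intro H
    refine hb fun c d => reachAvoiding_of_swapDarts ?_ (H c d)
    exact ((reachAvoiding_of_vert_eq hq).trans (reachAvoiding_dinv h1 h2)).trans
      (reachAvoiding_of_vert_eq hr.symm)

end CubicGraph

open CubicGraph

lemma boundaryCount_bridgedSet_le (n : ℕ) :
    boundaryCount n (bridgedSet n) ≤ 2 * Nat.card (bridgedSet n) := by
  classical
  have hb : ∀ u : bridgedSet n, ∃ x, (Quot.out u.1).1.IsBridge x := fun u => u.2
  choose b hb using hb
  have hinj : Nat.card {q : GammaV n × Fin 2 × Fin (6 * n) // q.1 ∈ bridgedSet n ∧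
      ∀ v : GammaV n, IsIsomorphic ((Quot.out q.1).1.wh q.2.1 q.2.2) (Quot.out v).1 →
        v ∉ bridgedSet n} ≤ Nat.card (bridgedSet n × Fin 2 × Fin 2) := by
    refine Nat.card_le_card_of_injective
      (fun q => (⟨q.1.1, q.2.1⟩, q.1.2.1, if q.1.2.2 = b ⟨q.1.1, q.2.1⟩ then 0 else 1)) ?_
    have key : ∀ q : {q : GammaV n × Fin 2 × Fin (6 * n) // q.1 ∈ bridgedSet n ∧
        ∀ v : GammaV n, IsIsomorphic ((Quot.out q.1).1.wh q.2.1 q.2.2) (Quot.out v).1 →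
        v ∉ bridgedSet n}, q.1.2.2 = b ⟨q.1.1, q.2.1⟩ ∨
          q.1.2.2 = (Quot.out q.1.1).1.dinv (b ⟨q.1.1, q.2.1⟩) := by
      rintro ⟨⟨u, i, x⟩, hu, hv⟩
      by_contra! hne
      have hc := connected_wh (Quot.out u).2 i x
      exact hv _ (isIsomorphic_out _ hc)
        (mk_mem_bridgedSet hc ⟨_, isBridge_wh (hb ⟨u, hu⟩) i hne.1 hne.2⟩)
    intro q q' h
    have hq := key q
    have hq' := key q'
    obtain ⟨⟨u, i, x⟩, hu, hv⟩ := q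
    obtain ⟨⟨u', i', x'⟩, hu', hv'⟩ := q'
    simp only [Prod.mk.injEq, Subtype.mk.injEq] at h hq hq'
    obtain ⟨rfl, rfl, h⟩ := h
    have : x = x' := by
      split_ifs at h with h1 h2 h2
      · rw [h1, h2]
      · simp at h
      · simp at h
      · rw [hq.resolve_left h1, hq'.resolve_left h2]
    subst this; rfl
  rw [Nat.card_prod, Nat.card_prod, Nat.card_fin] at hinj
  unfold boundaryCount
  omega

lemma dOut_eq (n : ℕ) (S : Set (GammaV n)) : dOut n S = 6 * n * Nat.card S := by
  have e : {q : GammaV n × Fin 2 × Fin (6 * n) // q.1 ∈ S} ≃ S × Fin 2 × Fin (6 * n) :=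
    { toFun := fun q => (⟨q.1.1, q.2⟩, q.1.2)
      invFun := fun q => ⟨(q.1.1, q.2), q.1.2⟩
      left_inv := fun _ => rfl
      right_inv := fun _ => rfl }
  rw [dOut, Nat.card_congr e, Nat.card_prod, Nat.card_prod, Nat.card_fin, Nat.card_fin]
  rw [show Nat.card S * (2 * (6 * n)) = 6 * n * Nat.card S * 2 by ring]
  exact Nat.mul_div_cancel _ (by norm_num)

lemma phiOutSet_bridgedSet_le (n : ℕ) (hn : 1 ≤ n)
    (h : dOut n ((bridgedSet n)ᶜ) ≤ dOut n (bridgedSet n)) :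
    phiOutSet n (bridgedSet n) ≤ (Nat.card (bridgedSet n) : ℝ)
      / (3 * n * (Nat.card ((bridgedSet n)ᶜ : Set (GammaV n)) : ℝ)) := by
  have h1 : (boundaryCount n (bridgedSet n) : ℝ) ≤ 2 * Nat.card (bridgedSet n) := by
    exact_mod_cast boundaryCount_bridgedSet_le n
  rw [phiOutSet, min_eq_right (by exact_mod_cast h), dOut_eq]
  push_cast
  rcases Nat.eq_zero_or_pos (Nat.card ((bridgedSet n)ᶜ : Set (GammaV n))) with h0 | h0
  · rw [h0]; simp
  · have hn' : (0 : ℝ) < n := by exact_mod_cast hn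
    have h0' : (0 : ℝ) < Nat.card ((bridgedSet n)ᶜ : Set (GammaV n)) := by exact_mod_cast h0
    rw [div_le_div_iff₀ (by positivity) (by positivity)]
    nlinarith [mul_pos hn' h0']

lemma phiOut_le_of_card_le (n : ℕ) (hn : 1 ≤ n)
    (h : Nat.card ((bridgedSet n)ᶜ : Set (GammaV n)) ≤ Nat.card (bridgedSet n))
    (hne : ((bridgedSet n)ᶜ).Nonempty) :
    phiOut n ≤ (Nat.card (bridgedSet n) : ℝ)
      / (3 * n * (Nat.card ((bridgedSet n)ᶜ : Set (GammaV n)) : ℝ)) := by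
  have hc : 0 < Nat.card ((bridgedSet n)ᶜ : Set (GammaV n)) := by
    have := hne.to_subtype
    exact Nat.card_pos
  refine le_trans (csInf_le ?_ ⟨bridgedSet n, ?_, hne, rfl⟩) (phiOutSet_bridgedSet_le n hn ?_)
  · refine ⟨0, ?_⟩
    rintro x ⟨S, -, -, rfl⟩
    unfold phiOutSet
    positivity
  · have := (Nat.card_pos_iff.1 (hc.trans_le h)).1
    exact Set.nonempty_coe_sort.1 this
  · rw [dOut_eq, dOut_eq]
    exact Nat.mul_le_mul_left _ h

namespace CubicGraph

variable {n : ℕ}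

lemma othersAt_card (g : CubicGraph n) (x : Fin (6 * n)) : (g.othersAt x).card = 2 := by
  have hx : x ∈ Finset.univ.filter fun d => g.vert d = g.vert x := by simp
  rw [othersAt, Finset.card_erase_of_mem hx, g.regular]

lemma oMin_ne_oMax (g : CubicGraph n) (x : Fin (6 * n)) : g.oMin x ≠ g.oMax x :=
  (Finset.min'_lt_max'_of_card _ (by rw [othersAt_card]; norm_num)).ne

lemma oMin_ne (g : CubicGraph n) (x : Fin (6 * n)) : g.oMin x ≠ x :=
  (mem_othersAt.1 (g.oMin_mem x)).1

lemma oMax_ne (g : CubicGraph n) (x : Fin (6 * n)) : g.oMax x ≠ x :=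
  (mem_othersAt.1 (g.oMax_mem x)).1

lemma vert_oMin (g : CubicGraph n) (x : Fin (6 * n)) : g.vert (g.oMin x) = g.vert x :=
  (mem_othersAt.1 (g.oMin_mem x)).2

lemma vert_oMax (g : CubicGraph n) (x : Fin (6 * n)) : g.vert (g.oMax x) = g.vert x :=
  (mem_othersAt.1 (g.oMax_mem x)).2

lemma eq_of_vert_eq {g : CubicGraph n} {a b c x : Fin (6 * n)} (hab : a ≠ b) (hac : a ≠ c)
    (hbc : b ≠ c) (hb : g.vert b = g.vert a) (hc : g.vert c = g.vert a)
    (hx : g.vert x = g.vert a) : x = a ∨ x = b ∨ x = c := by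
  have h : ({a, b, c} : Finset (Fin (6 * n))) =
      Finset.univ.filter fun d => g.vert d = g.vert a := by
    refine Finset.eq_of_subset_of_card_le ?_ ?_
    · intro y hy
      simp only [Finset.mem_insert, Finset.mem_singleton] at hy
      rcases hy with rfl | rfl | rfl <;> simp [*]
    · rw [g.regular, Finset.card_eq_three.2 ⟨a, b, c, hab, hac, hbc, rfl⟩]
  have hx' : x ∈ Finset.univ.filter fun d => g.vert d = g.vert a := by simp [hx]
  rw [← h] at hx'
  simpa using hx'

lemma eq_or_eq_oMin_or_eq_oMax {g : CubicGraph n} {x y : Fin (6 * n)} (h : g.vert y = g.vert x) :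
    y = x ∨ y = g.oMin x ∨ y = g.oMax x :=
  eq_of_vert_eq (g.oMin_ne x).symm (g.oMax_ne x).symm (g.oMin_ne_oMax x) (g.vert_oMin x)
    (g.vert_oMax x) h

lemma dinv_inj {g : CubicGraph n} {a b : Fin (6 * n)} : g.dinv a = g.dinv b ↔ a = b :=
  ⟨fun h => by rw [← g.dinv_invol a, h, g.dinv_invol], fun h => by rw [h]⟩

/-- The third dart at the vertex of a loop is a bridge. -/
lemma isBridge_of_isLoop {g : CubicGraph n} {x z : Fin (6 * n)} (hx : g.IsLoop x)
    (hz : g.vert z = g.vert x) (h1 : z ≠ x) (h2 : z ≠ g.dinv x) : g.IsBridge z := by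
  have h3 : ∀ y, g.vert y = g.vert x → y = x ∨ y = g.dinv x ∨ y = z := fun y hy =>
    eq_of_vert_eq (g.dinv_ne x).symm h1.symm h2.symm hx hz hy
  have hclosed : ∀ y, g.ReachAvoiding z x y → g.vert y = g.vert x := by
    intro y hy
    induction hy with
    | refl => rfl
    | tail _ h ih =>
      rcases h with h | ⟨rfl, h4, -⟩
      · rw [← h, ih]
      · rcases h3 _ ih with rfl | rfl | rfl
        · exact hx
        · rw [g.dinv_invol]
        · exact absurd rfl h4
  intro H
  rcases h3 _ (hclosed _ (H x (g.dinv z))) with h | h | h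
  · exact h2 (by rw [← h, g.dinv_invol])
  · exact h1 (dinv_inj.1 h)
  · exact g.dinv_ne z h

lemma Bridgeless.not_isLoop {g : CubicGraph n} (hg : g.Bridgeless) (x : Fin (6 * n)) :
    ¬ g.IsLoop x := by
  intro hx
  by_cases h : g.oMin x = g.dinv x
  · exact hg _ (isBridge_of_isLoop hx (g.vert_oMax x) (g.oMax_ne x)
      (by rw [← h]; exact (g.oMin_ne_oMax x).symm))
  · exact hg _ (isBridge_of_isLoop hx (g.vert_oMin x) (g.oMin_ne x) h)

/-- Cut the two edges at the vertex of `d` other than that of `d`, close up one pair of the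
resulting free ends to a loop at this vertex and join the other pair. -/
def pinch (g : CubicGraph n) (d : Fin (6 * n)) : CubicGraph n :=
  g.swapDarts (g.oMax d) (g.dinv (g.oMin d))

lemma pinch_vert (g : CubicGraph n) (d x : Fin (6 * n)) :
    (g.pinch d).vert x = g.vert (Equiv.swap (g.oMax d) (g.dinv (g.oMin d)) x) := rfl

lemma pinch_dinv (g : CubicGraph n) (d : Fin (6 * n)) : (g.pinch d).dinv = g.dinv := rfl

section Pinch

variable {g : CubicGraph n}

lemma vert_dinv_ne (hg : ∀ x, ¬ g.IsLoop x) {x y : Fin (6 * n)} (h : g.vert x = g.vert y) :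
    g.vert (g.dinv x) ≠ g.vert y :=
  fun h' => hg x (h'.trans h.symm)

lemma dinv_oMin_ne (hg : ∀ x, ¬ g.IsLoop x) (d : Fin (6 * n)) {x : Fin (6 * n)}
    (hx : g.vert x = g.vert d) :
    x ≠ g.dinv (g.oMin d) := by
  rintro rfl
  exact vert_dinv_ne hg (g.vert_oMin d) hx

lemma pinch_vert_self (hg : ∀ x, ¬ g.IsLoop x) (d : Fin (6 * n)) :
    (g.pinch d).vert d = g.vert d := by
  rw [pinch_vert, Equiv.swap_apply_of_ne_of_ne (g.oMax_ne d).symm (dinv_oMin_ne hg d rfl)]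

lemma pinch_vert_oMin (d : Fin (6 * n)) : (g.pinch d).vert (g.oMin d) = g.vert d := by
  rw [pinch_vert, Equiv.swap_apply_of_ne_of_ne (g.oMin_ne_oMax d) (g.dinv_ne _).symm,
    vert_oMin]

lemma pinch_vert_dinv_oMin (d : Fin (6 * n)) : (g.pinch d).vert (g.dinv (g.oMin d)) = g.vert d := by
  rw [pinch_vert, Equiv.swap_apply_right, vert_oMax]

lemma isLoop_pinch_oMin (d : Fin (6 * n)) : (g.pinch d).IsLoop (g.oMin d) := by
  rw [IsLoop, pinch_dinv, pinch_vert_oMin, pinch_vert_dinv_oMin]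

lemma of_isLoop_pinch (hg : ∀ x, ¬ g.IsLoop x) (d : Fin (6 * n)) {x : Fin (6 * n)}
    (hx : (g.pinch d).IsLoop x) :
    x = g.oMin d ∨ x = g.dinv (g.oMin d) ∨ x = g.oMax d ∨ x = g.dinv (g.oMax d) := by
  by_contra! h
  obtain ⟨h1, h2, h3, h4⟩ := h
  have h5 : g.dinv x ≠ g.oMax d := fun h => h4 (by rw [← h, g.dinv_invol])
  have h6 : g.dinv x ≠ g.dinv (g.oMin d) := fun h => h1 (dinv_inj.1 h)
  rw [IsLoop, pinch_dinv, pinch_vert, pinch_vert, Equiv.swap_apply_of_ne_of_ne h3 h2,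
    Equiv.swap_apply_of_ne_of_ne h5 h6] at hx
  exact hg x hx

lemma isBridge_pinch (hg : ∀ x, ¬ g.IsLoop x) (d : Fin (6 * n)) : (g.pinch d).IsBridge d := by
  refine isBridge_of_isLoop (isLoop_pinch_oMin d) ?_ (g.oMin_ne d).symm (dinv_oMin_ne hg d rfl)
  rw [pinch_vert_self hg, pinch_vert_oMin]

lemma connected_pinch (hg : ∀ x, ¬ g.IsLoop x) (d : Fin (6 * n)) (hd : ¬ g.IsBridge d) :
    (g.pinch d).Connected := by
  classical
  have hd' : ∀ a b, g.ReachAvoiding d a b := not_not.1 hd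
  let f : Fin (6 * n) → Fin (6 * n) := fun x =>
    if g.vert x = g.vert d ∨ x = g.dinv (g.oMin d) then g.oMax d else x
  have hf1 : ∀ x, g.vert x = g.vert d → f x = g.oMax d := fun x hx => if_pos (Or.inl hx)
  have hf2 : f (g.dinv (g.oMin d)) = g.oMax d := if_pos (Or.inr rfl)
  have hf3 : ∀ x, g.vert x ≠ g.vert d → x ≠ g.dinv (g.oMin d) → f x = x :=
    fun x h1 h2 => if_neg (by tauto)
  have hfv : ∀ x, g.vert x ≠ g.vert d → (g.pinch d).vert (f x) = g.vert x := by
    intro x hx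
    by_cases h : x = g.dinv (g.oMin d)
    · rw [h, hf2, pinch_vert, Equiv.swap_apply_left]
    · rw [hf3 x hx h, pinch_vert, Equiv.swap_apply_of_ne_of_ne ?_ h]
      rintro rfl; exact hx (g.vert_oMax d)
  have hβ : f (g.dinv (g.oMax d)) = g.dinv (g.oMax d) :=
    hf3 _ (vert_dinv_ne hg (g.vert_oMax d)) fun h => g.oMin_ne_oMax d (dinv_inj.1 h).symm
  have hreach : ∀ a b, (g.pinch d).Reach (f a) (f b) := by
    intro a b
    have hab := hd' a b
    induction hab with
    | refl => exact Relation.ReflTransGen.refl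
    | @tail x y _ h ih =>
      refine ih.trans ?_
      rcases h with h | ⟨rfl, h1, h2⟩
      · by_cases hx : g.vert x = g.vert d
        · rw [hf1 x hx, hf1 y (h ▸ hx)]; exact Relation.ReflTransGen.refl
        · refine reach_of_vert_eq ?_
          rw [hfv x hx, hfv y (h ▸ hx), h]
      · by_cases hx : g.vert x = g.vert d
        · rcases eq_or_eq_oMin_or_eq_oMax hx with rfl | rfl | rfl
          · exact absurd rfl h1
          · rw [hf1 _ hx, hf2]; exact Relation.ReflTransGen.refl
          · rw [hf1 _ hx, hβ]; exact reach_dinv (g.pinch d) _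
        · by_cases hy : g.vert (g.dinv x) = g.vert d
          · rcases eq_or_eq_oMin_or_eq_oMax hy with h | h | h
            · exact absurd (by rw [← h, g.dinv_invol]) h2
            · rw [h, hf1 _ (g.vert_oMin d), show x = g.dinv (g.oMin d) by rw [← h, g.dinv_invol],
                hf2]
              exact Relation.ReflTransGen.refl
            · rw [h, hf1 _ (g.vert_oMax d), show x = g.dinv (g.oMax d) by rw [← h, g.dinv_invol],
                hβ]
              exact (reach_dinv (g.pinch d) _).symm
          · rw [hf3 x hx ?_, hf3 _ hy ?_]
            · exact reach_dinv (g.pinch d) _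
            · exact fun h => hx (by rw [dinv_inj.1 h, vert_oMin])
            · rintro rfl; exact hy (by rw [g.dinv_invol, vert_oMin])
  have hq : f (g.oMax d) = g.oMax d := hf1 _ (g.vert_oMax d)
  have hd2 : (g.pinch d).Reach d (g.oMax d) := by
    refine (reach_dinv (g.pinch d) d).trans ?_
    have := hreach (g.dinv d) (g.oMax d)
    rwa [hq, hf3 _ (vert_dinv_ne hg rfl) fun h => g.oMin_ne d (dinv_inj.1 h).symm] at this
  have hall : ∀ x, (g.pinch d).Reach x (g.oMax d) := by
    intro x
    by_cases hx : x = g.dinv (g.oMin d)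
    · refine Reach.trans (reach_of_vert_eq ?_) hd2
      rw [hx, pinch_vert_dinv_oMin, pinch_vert_self hg]
    · by_cases hx' : g.vert x = g.vert d
      · rcases eq_or_eq_oMin_or_eq_oMax hx' with rfl | rfl | rfl
        · exact hd2
        · refine Reach.trans (reach_of_vert_eq ?_) hd2
          rw [pinch_vert_oMin, pinch_vert_self hg]
        · exact Relation.ReflTransGen.refl
      · have := hreach x (g.oMax d)
        rwa [hq, hf3 _ hx' hx] at this
  exact fun a b => (hall a).trans (hall b).symm

end Pinch

lemma IsDartIso.swapDarts {g₁ g₂ : CubicGraph n} {f : Equiv.Perm (Fin (6 * n))}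
    (h : IsDartIso g₁ g₂ f) (a b : Fin (6 * n)) :
    IsDartIso (g₁.swapDarts a b) (g₂.swapDarts (f a) (f b)) f := by
  refine ⟨h.1, fun x y => ?_⟩
  have hs : ∀ x, Equiv.swap (f a) (f b) (f x) = f (Equiv.swap a b x) := fun x =>
    f.injective.swap_apply a b x
  simp only [CubicGraph.swapDarts, hs]
  exact h.2 _ _

lemma isDartIso_swap_of_isLoop {g : CubicGraph n} {x : Fin (6 * n)} (hx : g.IsLoop x) :
    IsDartIso g g (Equiv.swap x (g.dinv x)) := by
  have hv : ∀ y, g.vert (Equiv.swap x (g.dinv x) y) = g.vert y := by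
    intro y
    rw [Equiv.swap_apply_def]
    split_ifs with h1 h2
    · rw [h1]; exact hx
    · rw [h2]; exact hx.symm
    · rfl
  refine ⟨fun y => ?_, fun y z => by rw [hv, hv]⟩
  by_cases h1 : y = x
  · subst h1; simp [g.dinv_invol]
  by_cases h2 : y = g.dinv x
  · subst h2; simp [g.dinv_invol]
  rw [Equiv.swap_apply_of_ne_of_ne h1 h2, Equiv.swap_apply_of_ne_of_ne]
  · rintro rfl; exact h2 (g.dinv_invol _).symm
  · exact fun h => h1 (dinv_inj.1 h)

lemma isDartIso_swapDarts_dinv {h : CubicGraph n} {p q : Fin (6 * n)}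
    (h1 : p ≠ q) (h2 : p ≠ h.dinv q) :
    IsDartIso (h.swapDarts (h.dinv q) p) (h.swapDarts q (h.dinv p))
      (Equiv.swap p (h.dinv q) * Equiv.swap (h.dinv p) q) := by
  have h3 : h.dinv p ≠ q := fun e => h2 (by rw [← e, h.dinv_invol])
  have h4 : h.dinv p ≠ h.dinv q := fun e => h1 (dinv_inj.1 e)
  have h5 := h.dinv_ne p
  have h6 := h.dinv_ne q
  have e1 : (Equiv.swap p (h.dinv q) * Equiv.swap (h.dinv p) q) p = h.dinv q := by
    rw [Equiv.Perm.mul_apply, Equiv.swap_apply_of_ne_of_ne h5.symm h1, Equiv.swap_apply_left]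
  have e2 : (Equiv.swap p (h.dinv q) * Equiv.swap (h.dinv p) q) (h.dinv p) = q := by
    rw [Equiv.Perm.mul_apply, Equiv.swap_apply_left, Equiv.swap_apply_of_ne_of_ne h1.symm h6.symm]
  have e3 : (Equiv.swap p (h.dinv q) * Equiv.swap (h.dinv p) q) q = h.dinv p := by
    rw [Equiv.Perm.mul_apply, Equiv.swap_apply_right, Equiv.swap_apply_of_ne_of_ne h5 h4]
  have e4 : (Equiv.swap p (h.dinv q) * Equiv.swap (h.dinv p) q) (h.dinv q) = p := by
    rw [Equiv.Perm.mul_apply, Equiv.swap_apply_of_ne_of_ne h4.symm h6, Equiv.swap_apply_right]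
  have e5 : ∀ x, x ≠ p → x ≠ q → x ≠ h.dinv p → x ≠ h.dinv q →
      (Equiv.swap p (h.dinv q) * Equiv.swap (h.dinv p) q) x = x := by
    intro x a b c d
    rw [Equiv.Perm.mul_apply, Equiv.swap_apply_of_ne_of_ne c b, Equiv.swap_apply_of_ne_of_ne a d]
  generalize Equiv.swap p (h.dinv q) * Equiv.swap (h.dinv p) q = t at *
  have hv : ∀ x, (h.swapDarts q (h.dinv p)).vert (t x) = (h.swapDarts (h.dinv q) p).vert x := by
    intro x
    simp only [CubicGraph.swapDarts]
    by_cases a : x = p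
    · rw [a, e1, Equiv.swap_apply_right, Equiv.swap_apply_of_ne_of_ne h6 h4.symm]
    by_cases b : x = q
    · rw [b, e3, Equiv.swap_apply_right, Equiv.swap_apply_of_ne_of_ne h6.symm h1.symm]
    by_cases c : x = h.dinv p
    · rw [c, e2, Equiv.swap_apply_left, Equiv.swap_apply_of_ne_of_ne h4 h5]
    by_cases d : x = h.dinv q
    · rw [d, e4, Equiv.swap_apply_left, Equiv.swap_apply_of_ne_of_ne h1 h5.symm]
    rw [e5 x a b c d, Equiv.swap_apply_of_ne_of_ne b c, Equiv.swap_apply_of_ne_of_ne d a]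
  refine ⟨fun x => ?_, fun x y => by rw [hv, hv]⟩
  change h.dinv (t x) = t (h.dinv x)
  by_cases a : x = p
  · rw [a, e1, e2, h.dinv_invol]
  by_cases b : x = q
  · rw [b, e3, e4, h.dinv_invol]
  by_cases c : x = h.dinv p
  · rw [c, e2, h.dinv_invol, e1]
  by_cases d : x = h.dinv q
  · rw [d, e4, h.dinv_invol, e3]
  rw [e5 x a b c d, e5]
  · exact fun e => c (by rw [← e, h.dinv_invol])
  · exact fun e => d (by rw [← e, h.dinv_invol])
  · exact fun e => a (dinv_inj.1 e)
  · exact fun e => b (dinv_inj.1 e)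

lemma exists_isDartIso_of_pinch {g₁ g₂ : CubicGraph n} (hg₁ : ∀ x, ¬ g₁.IsLoop x)
    (hg₂ : ∀ x, ¬ g₂.IsLoop x) {d₁ d₂ : Fin (6 * n)} {f : Equiv.Perm (Fin (6 * n))}
    (hf : IsDartIso (g₁.pinch d₁) (g₂.pinch d₂) f)
    (hq : f (g₁.oMax d₁) = g₂.oMax d₂ ∨ f (g₁.oMax d₁) = g₂.dinv (g₂.oMax d₂)) :
    ∃ f', IsDartIso g₁ g₂ f' ∧ f' d₁ = d₂ := by
  have key : ∀ f : Equiv.Perm (Fin (6 * n)), IsDartIso (g₁.pinch d₁) (g₂.pinch d₂) f →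
      (f (g₁.oMax d₁) = g₂.oMax d₂ ∧ f (g₁.oMin d₁) = g₂.oMin d₂) ∨
      (f (g₁.oMax d₁) = g₂.dinv (g₂.oMax d₂) ∧ f (g₁.oMin d₁) = g₂.dinv (g₂.oMin d₂)) →
      ∃ f', IsDartIso g₁ g₂ f' ∧ f' d₁ = d₂ := by
    intro f hf hc
    have hdp : ∀ x, g₂.dinv (f x) = f (g₁.dinv x) := hf.1
    have hd : f d₁ = d₂ := by
      have hv : (g₂.pinch d₂).vert (f d₁) = (g₂.pinch d₂).vert (g₂.oMin d₂) := by
        have h1 : (g₂.pinch d₂).vert (f d₁) = (g₂.pinch d₂).vert (f (g₁.oMin d₁)) := by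
          rw [← hf.2, pinch_vert_self hg₁, pinch_vert_oMin]
        rcases hc with hc | hc
        · rw [h1, hc.2]
        · rw [h1, hc.2, pinch_vert_oMin, pinch_vert_dinv_oMin]
      have h3 := eq_of_vert_eq (g := g₂.pinch d₂) (g₂.dinv_ne (g₂.oMin d₂)).symm (g₂.oMin_ne d₂)
        (dinv_oMin_ne hg₂ d₂ rfl).symm (by rw [pinch_vert_dinv_oMin, pinch_vert_oMin])
        (by rw [pinch_vert_self hg₂, pinch_vert_oMin]) hv
      have h4 : f d₁ ≠ f (g₁.oMin d₁) := fun h => g₁.oMin_ne d₁ (f.injective h).symm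
      have h5 : f d₁ ≠ f (g₁.dinv (g₁.oMin d₁)) :=
        fun h => dinv_oMin_ne hg₁ d₁ rfl (f.injective h)
      rw [← hdp] at h5
      rcases hc with hc | hc
      · rw [hc.2] at h4 h5; tauto
      · rw [hc.2, g₂.dinv_invol] at h5; rw [hc.2] at h4; tauto
    have hs := hf.swapDarts (g₁.oMax d₁) (g₁.dinv (g₁.oMin d₁))
    have e1 : (g₁.pinch d₁).swapDarts (g₁.oMax d₁) (g₁.dinv (g₁.oMin d₁)) = g₁ :=
      swapDarts_swapDarts _ _ _
    have e2 : (g₂.pinch d₂).swapDarts (g₂.oMax d₂) (g₂.dinv (g₂.oMin d₂)) = g₂ :=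
      swapDarts_swapDarts _ _ _
    rw [e1, ← hdp] at hs
    rcases hc with hc | hc
    · rw [hc.1, hc.2, e2] at hs
      exact ⟨f, hs, hd⟩
    · rw [hc.1, hc.2, g₂.dinv_invol] at hs
      have ht := isDartIso_swapDarts_dinv (h := g₂.pinch d₂) (g₂.oMin_ne_oMax d₂)
        (q := g₂.oMax d₂) (fun h => dinv_oMin_ne hg₂ d₂ (g₂.vert_oMax d₂) (by
          rw [pinch_dinv] at h; rw [h, g₂.dinv_invol]))
      rw [pinch_dinv, e2] at ht
      refine ⟨_, hs.trans ht, ?_⟩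
      rw [Equiv.trans_apply, hd, Equiv.Perm.mul_apply,
        Equiv.swap_apply_of_ne_of_ne (dinv_oMin_ne hg₂ d₂ rfl) (g₂.oMax_ne d₂).symm,
        Equiv.swap_apply_of_ne_of_ne (g₂.oMin_ne d₂).symm]
      exact fun h => vert_dinv_ne hg₂ (g₂.vert_oMax d₂) (by rw [← h])
  have hl : (g₂.pinch d₂).IsLoop (f (g₁.oMin d₁)) := by
    have := isLoop_pinch_oMin (g := g₁) d₁
    rw [IsLoop] at this ⊢
    rw [hf.1, ← hf.2, this]
  have hdp : ∀ x, g₂.dinv (f x) = f (g₁.dinv x) := hf.1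
  have hne1 : f (g₁.oMin d₁) ≠ f (g₁.oMax d₁) := fun h => g₁.oMin_ne_oMax d₁ (f.injective h)
  have hne2 : f (g₁.oMin d₁) ≠ g₂.dinv (f (g₁.oMax d₁)) := by
    rw [hdp]
    intro h
    exact dinv_oMin_ne hg₁ d₁ (g₁.vert_oMax d₁) (by rw [f.injective h, g₁.dinv_invol])
  have hp : f (g₁.oMin d₁) = g₂.oMin d₂ ∨ f (g₁.oMin d₁) = g₂.dinv (g₂.oMin d₂) := by
    have := of_isLoop_pinch hg₂ d₂ hl
    rcases hq with hq | hq
    · rw [hq] at hne1 hne2; tauto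
    · rw [hq, g₂.dinv_invol] at hne2; rw [hq] at hne1; tauto
  have hflip := isDartIso_swap_of_isLoop (isLoop_pinch_oMin (g := g₂) d₂)
  rw [pinch_dinv] at hflip
  have hfix : ∀ x, x = g₂.oMax d₂ ∨ x = g₂.dinv (g₂.oMax d₂) →
      Equiv.swap (g₂.oMin d₂) (g₂.dinv (g₂.oMin d₂)) x = x := by
    rintro x (rfl | rfl)
    · exact Equiv.swap_apply_of_ne_of_ne (g₂.oMin_ne_oMax d₂).symm
        (dinv_oMin_ne hg₂ d₂ (g₂.vert_oMax d₂))
    · refine Equiv.swap_apply_of_ne_of_ne ?_ fun h => g₂.oMin_ne_oMax d₂ (dinv_inj.1 h).symm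
      exact fun h => vert_dinv_ne hg₂ (g₂.vert_oMax d₂) (by rw [h, vert_oMin])
  rcases hp with hp | hp <;> rcases hq with hq | hq
  · exact key f hf (Or.inl ⟨hq, hp⟩)
  · refine key _ (hf.trans hflip) (Or.inr ⟨?_, ?_⟩)
    · rw [Equiv.trans_apply, hq, hfix _ (Or.inr rfl)]
    · rw [Equiv.trans_apply, hp, Equiv.swap_apply_left]
  · refine key _ (hf.trans hflip) (Or.inl ⟨?_, ?_⟩)
    · rw [Equiv.trans_apply, hq, hfix _ (Or.inl rfl)]
    · rw [Equiv.trans_apply, hp, Equiv.swap_apply_right]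
  · exact key f hf (Or.inr ⟨hq, hp⟩)

/-- The automorphism group of a cubic graph, as a group of permutations of the darts. -/
def autGroup (g : CubicGraph n) : Subgroup (Equiv.Perm (Fin (6 * n))) where
  carrier := {f | IsDartIso g g f}
  mul_mem' := fun ha hb => IsDartIso.trans hb ha
  one_mem' := IsDartIso.refl g
  inv_mem' := fun ha => IsDartIso.symm ha

/-- The set of orbits of darts under automorphisms. -/
abbrev DartOrbits (g : CubicGraph n) : Type := MulAction.orbitRel.Quotient g.autGroup (Fin (6 * n))

end CubicGraph

open CubicGraph

/-- Double counting of the pinching operation. -/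
lemma sum_card_dartOrbits_le (n : ℕ) :
    Nat.card (Σ u : ((bridgedSet n)ᶜ : Set (GammaV n)), (Quot.out u.1).1.DartOrbits) * 2
      ≤ Nat.card (bridgedSet n) * (6 * n) := by
  classical
  have hbl : ∀ u : ((bridgedSet n)ᶜ : Set (GammaV n)), (Quot.out u.1).1.Bridgeless :=
    fun u x hx => u.2 ⟨x, hx⟩
  have hconn : ∀ (u : ((bridgedSet n)ᶜ : Set (GammaV n))) d, ((Quot.out u.1).1.pinch d).Connected :=
    fun u d => connected_pinch (hbl u).not_isLoop d (hbl u d)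
  have hex : ∀ (u : ((bridgedSet n)ᶜ : Set (GammaV n))) d, ∃ (w : bridgedSet n) (f : _),
      IsDartIso ((Quot.out u.1).1.pinch d) (Quot.out w.1).1 f := by
    intro u d
    obtain ⟨f, hf⟩ := isIsomorphic_iff.1 (isIsomorphic_out _ (hconn u d))
    exact ⟨⟨_, mk_mem_bridgedSet (hconn u d) ⟨d, isBridge_pinch (hbl u).not_isLoop d⟩⟩, f, hf⟩
  choose w f hf using hex
  have := Nat.card_le_card_of_injective
    (fun p : (Σ u : ((bridgedSet n)ᶜ : Set (GammaV n)), (Quot.out u.1).1.DartOrbits) × Fin 2 =>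
      ((w p.1.1 p.1.2.out, f p.1.1 p.1.2.out (if p.2 = 0
        then (Quot.out p.1.1.1).1.oMax p.1.2.out
        else (Quot.out p.1.1.1).1.dinv ((Quot.out p.1.1.1).1.oMax p.1.2.out))) :
        bridgedSet n × Fin (6 * n))) ?_
  · simpa [Nat.card_prod] using this
  rintro ⟨⟨u₁, o₁⟩, b₁⟩ ⟨⟨u₂, o₂⟩, b₂⟩ h
  simp only [Prod.mk.injEq] at h
  obtain ⟨hw, hx⟩ := h
  have hf₁ := hf u₁ o₁.out
  have hf₂ := hf u₂ o₂.out
  rw [← hw] at hf₂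
  have hF := hf₁.trans hf₂.symm
  obtain ⟨f', hf', hd⟩ := exists_isDartIso_of_pinch (hbl u₁).not_isLoop (hbl u₂).not_isLoop hF (by
    have e : ∀ x y, f u₁ o₁.out x = f u₂ o₂.out y →
        ((f u₁ o₁.out).trans (f u₂ o₂.out).symm) x = y := by
      intro x y hxy; rw [Equiv.trans_apply, hxy, Equiv.symm_apply_apply]
    have e' : ∀ x, ((f u₁ o₁.out).trans (f u₂ o₂.out).symm) ((Quot.out u₁.1).1.dinv x) =
        (Quot.out u₂.1).1.dinv (((f u₁ o₁.out).trans (f u₂ o₂.out).symm) x) :=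
      fun x => (hF.1 x).symm
    have := e _ _ hx
    split_ifs at this
    · exact Or.inl this
    · exact Or.inr this
    · refine Or.inr ?_
      rw [← this, e', CubicGraph.dinv_invol]
    · refine Or.inl ?_
      rw [e'] at this
      exact dinv_inj.1 this)
  have hu : u₁ = u₂ := Subtype.ext (gammaV_eq (isIsomorphic_iff.2 ⟨f', hf'⟩))
  subst hu
  have ho : o₁ = o₂ := by
    rw [← Quotient.out_eq o₁, ← Quotient.out_eq o₂]
    refine Quotient.sound ?_
    change _ ∈ MulAction.orbit _ _
    exact MulAction.mem_orbit_symm.1 ⟨⟨f', hf'⟩, hd⟩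
  subst ho
  have hb : b₁ = b₂ := by
    have := (f u₁ o₁.out).injective hx
    have hne := (Quot.out u₁.1).1.dinv_ne ((Quot.out u₁.1).1.oMax o₁.out)
    split_ifs at this with h1 h2 h2
    · rw [h1, h2]
    · exact absurd this.symm hne
    · exact absurd this hne
    · omega
  rw [hb]

section Counting

open Equiv.Perm

variable {α : Type*}

/-- The cycles of a permutation, including the trivial ones. -/
abbrev CycleSpace (f : Equiv.Perm α) : Type _ := Quotient (SameCycle.setoid f)

lemma card_cycleSpace_mul_two_le [Fintype α] [DecidableEq α] (f : Equiv.Perm α) :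
    Nat.card (CycleSpace f) * 2
      ≤ Fintype.card α + (Finset.univ.filter fun x => f x = x).card := by
  have key : Function.Injective (fun p : CycleSpace f × Fin 2 =>
      (if p.2 = 0 then Sum.inl p.1.out else
        if h : f p.1.out = p.1.out then Sum.inr ⟨p.1.out, h⟩ else Sum.inl (f p.1.out) :
        α ⊕ {x // f x = x})) := by
    have h0 : ∀ o o' : CycleSpace f, SameCycle f o.out o'.out → o = o' := by
      intro o o' h
      rw [← Quotient.out_eq o, ← Quotient.out_eq o']
      exact Quotient.sound h
    have h2 : ∀ b : Fin 2, b ≠ 0 → b = 1 := by decide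
    rintro ⟨o, b⟩ ⟨o', b'⟩ h
    dsimp only at h
    split_ifs at h with h1 h3 h4 h5 h6 h7 h8
    · rw [h1, h3, h0 o o' (by rw [Sum.inl.inj h])]
    · have e := Sum.inl.inj h
      have : o = o' := h0 _ _ (by rw [e]; exact sameCycle_apply_left.2 (SameCycle.refl _ _))
      subst this
      exact absurd e.symm h4
    · have e : o.out = o'.out := congrArg Subtype.val (Sum.inr.inj h)
      rw [h2 _ h1, h2 b' (by assumption), h0 o o' (by rw [e])]
    · have e := Sum.inl.inj h
      have : o = o' := h0 _ _ (by rw [← e]; exact sameCycle_apply_right.2 (SameCycle.refl _ _))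
      subst this
      exact absurd e h5
    · have e := f.injective (Sum.inl.inj h)
      rw [h2 _ h1, h2 b' (by assumption), h0 o o' (by rw [e])]
  have := Nat.card_le_card_of_injective _ key
  rw [Nat.card_prod, Nat.card_sum, Nat.card_eq_fintype_card (α := Fin 2),
    Nat.card_eq_fintype_card (α := α), Nat.card_eq_fintype_card (α := {x // f x = x}),
    Fintype.card_fin, Fintype.card_subtype] at this
  exact this

/-- Fixed-point-free involutions commuting with `f`. -/
abbrev CommMatching (f : Equiv.Perm α) : Type _ :=
  {m : α → α // (∀ x, m (m x) = x) ∧ (∀ x, m x ≠ x) ∧ ∀ x, m (f x) = f (m x)}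

lemma CommMatching.zpow {f : Equiv.Perm α} (m : CommMatching f) (i : ℤ) (x : α) :
    m.1 ((f ^ i) x) = (f ^ i) (m.1 x) := by
  let e : Equiv.Perm α := ⟨m.1, m.1, m.2.1, m.2.1⟩
  have hc : Commute e f := Equiv.ext m.2.2.2
  exact DFunLike.congr_fun (hc.zpow_right i).eq x

lemma CommMatching.sameCycle {f : Equiv.Perm α} (m : CommMatching f) {x y : α}
    (h : SameCycle f x y) : SameCycle f (m.1 x) (m.1 y) := by
  obtain ⟨i, rfl⟩ := h
  exact ⟨i, (m.zpow i x).symm⟩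

/-- The involution on cycles induced by a commuting matching. -/
def CommMatching.onCycles {f : Equiv.Perm α} (m : CommMatching f) :
    CycleSpace f → CycleSpace f :=
  Quotient.map m.1 fun _ _ h => m.sameCycle h

lemma zpow_apply_eq_of_two_mul {f : Equiv.Perm α} {x : α} {i j : ℤ}
    (hi : (f ^ (2 * i)) x = x) (hi' : (f ^ i) x ≠ x) (hj : (f ^ (2 * j)) x = x)
    (hj' : (f ^ j) x ≠ x) : (f ^ i) x = (f ^ j) x := by
  have key : ∀ k : ℤ, (f ^ k) x = x ↔ (Function.minimalPeriod (f • ·) x : ℤ) ∣ k :=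
    fun k => MulAction.zpow_smul_eq_iff_minimalPeriod_dvd (a := f) (b := x)
  rw [key] at hi hj
  rw [Ne, key] at hi' hj'
  generalize (Function.minimalPeriod (f • ·) x : ℤ) = L at *
  have h : L ∣ i - j := by
    obtain ⟨a, ha⟩ := hi
    obtain ⟨b, hb⟩ := hj
    rcases Int.even_or_odd' a with ⟨c, rfl | rfl⟩
    · exact absurd ⟨c, by linarith⟩ hi'
    rcases Int.even_or_odd' b with ⟨d, rfl | rfl⟩
    · exact absurd ⟨d, by linarith⟩ hj'
    exact ⟨c - d, by linarith⟩
  have h2 : (f ^ (i - j)) x = x := (key _).2 h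
  have h3 : (f ^ (j + (i - j))) x = (f ^ j) ((f ^ (i - j)) x) := by
    rw [zpow_add]; rfl
  rw [h2, add_sub_cancel] at h3
  exact h3

lemma card_commMatching_le [Fintype α] [Nonempty α] (f : Equiv.Perm α) :
    Nat.card (CommMatching f)
      ≤ 2 ^ Fintype.card α * Fintype.card α ^ (Nat.card (CycleSpace f) / 2) := by
  classical
  have : Fintype (CycleSpace f) := Fintype.ofFinite _
  let e := Fintype.equivFin (CycleSpace f)
  have hinv : ∀ (m : CommMatching f) o, m.onCycles (m.onCycles o) = o := by
    intro m o
    induction o using Quotient.inductionOn with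
    | h x => exact congrArg _ (m.2.1 x)
  let A : CommMatching f → Finset (CycleSpace f) := fun m =>
    Finset.univ.filter fun o => e o < e (m.onCycles o)
  have hA : ∀ m o, o ∈ A m ↔ e o < e (m.onCycles o) := fun m o => by simp [A]
  have hcard : ∀ m, (A m).card ≤ Nat.card (CycleSpace f) / 2 := by
    intro m
    have hi : Function.Injective m.onCycles := Function.LeftInverse.injective (hinv m)
    have hd : Disjoint (A m) ((A m).image m.onCycles) := by
      rw [Finset.disjoint_left]
      intro o ho ho'
      obtain ⟨o', h1, rfl⟩ := Finset.mem_image.1 ho'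
      rw [hA, hinv] at ho
      rw [hA] at h1
      exact lt_asymm ho h1
    have h1 := Finset.card_le_univ ((A m) ∪ (A m).image m.onCycles)
    rw [Finset.card_union_of_disjoint hd, Finset.card_image_of_injective _ hi] at h1
    rw [Nat.card_eq_fintype_card]
    omega
  let code : CommMatching f →
      Σ S : {S : Finset (CycleSpace f) // S.card ≤ Nat.card (CycleSpace f) / 2}, (S.1 → α) :=
    fun m => ⟨⟨A m, hcard m⟩, fun o => m.1 o.1.out⟩
  have hinj : Function.Injective code := by
    intro m₁ m₂ h
    have hAA : A m₁ = A m₂ := congrArg (fun s => s.1.1) h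
    have hval : ∀ o ∈ A m₁, m₁.1 o.out = m₂.1 o.out := by
      have : ∀ (s t : Σ S : {S : Finset (CycleSpace f) //
          S.card ≤ Nat.card (CycleSpace f) / 2}, (S.1 → α)), s = t →
          ∀ o (h1 : o ∈ s.1.1) (h2 : o ∈ t.1.1), s.2 ⟨o, h1⟩ = t.2 ⟨o, h2⟩ := by
        rintro s _ rfl o _ _; rfl
      exact fun o ho => this _ _ h o ho (by change o ∈ A m₂; rwa [← hAA])
    have hin : ∀ x : α, (⟦x⟧ : CycleSpace f) ∈ A m₁ → m₁.1 x = m₂.1 x := by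
      intro x hx
      obtain ⟨i, hi⟩ : SameCycle f (Quotient.out (⟦x⟧ : CycleSpace f)) x :=
        Quotient.exact (s := SameCycle.setoid f) (Quotient.out_eq (⟦x⟧ : CycleSpace f))
      rw [← hi, m₁.zpow, m₂.zpow, hval _ hx]
    have hfix : ∀ m : CommMatching f, ∀ x : α, (⟦x⟧ : CycleSpace f) ∉ A m →
        m.onCycles ⟦x⟧ ∉ A m → ∃ i : ℤ, (f ^ i) x = m.1 x := by
      intro m x h1 h2
      rw [hA] at h1 h2
      rw [hinv] at h2
      have h3 : (⟦x⟧ : CycleSpace f) = m.onCycles ⟦x⟧ :=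
        e.injective (le_antisymm (not_lt.1 h2) (not_lt.1 h1))
      exact (Quotient.exact h3 : SameCycle f x (m.1 x))
    have hper : ∀ (m : CommMatching f) (x : α) (i : ℤ), (f ^ i) x = m.1 x →
        (f ^ (2 * i)) x = x ∧ (f ^ i) x ≠ x := by
      intro m x i hi
      refine ⟨?_, by rw [hi]; exact m.2.2.1 x⟩
      rw [two_mul, zpow_add, Equiv.Perm.mul_apply, hi, ← m.zpow, hi, m.2.1]
    refine Subtype.ext (funext fun x => ?_)
    have htwo : ∀ m m' : CommMatching f, (∀ x : α, (⟦x⟧ : CycleSpace f) ∈ A m → m.1 x = m'.1 x) →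
        (⟦m.1 x⟧ : CycleSpace f) ∈ A m → m.1 x = m'.1 x := by
      intro m m' hmm h
      have := hmm _ h
      rw [m.2.1] at this
      exact (m'.2.1 _).symm.trans (congrArg m'.1 this.symm)
    by_cases h1 : (⟦x⟧ : CycleSpace f) ∈ A m₁
    · exact hin x h1
    by_cases h2 : (⟦m₁.1 x⟧ : CycleSpace f) ∈ A m₁
    · exact htwo m₁ m₂ hin h2
    by_cases h3 : (⟦m₂.1 x⟧ : CycleSpace f) ∈ A m₂
    · exact (htwo m₂ m₁ (fun y hy => (hin y (hAA ▸ hy)).symm) h3).symm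
    obtain ⟨i, hi⟩ := hfix m₁ x h1 h2
    obtain ⟨j, hj⟩ := hfix m₂ x (hAA ▸ h1) h3
    obtain ⟨hi1, hi2⟩ := hper m₁ x i hi
    obtain ⟨hj1, hj2⟩ := hper m₂ x j hj
    rw [← hi, ← hj, zpow_apply_eq_of_two_mul hi1 hi2 hj1 hj2]
  refine (Nat.card_le_card_of_injective code hinj).trans ?_
  rw [Nat.card_eq_fintype_card, Fintype.card_sigma]
  refine (Finset.sum_le_card_nsmul _ _ (Fintype.card α ^ (Nat.card (CycleSpace f) / 2)) ?_).trans ?_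
  · intro S _
    rw [Fintype.card_fun, Fintype.card_coe]
    exact Nat.pow_le_pow_right Fintype.card_pos S.2
  · rw [smul_eq_mul]
    refine Nat.mul_le_mul_right _ ?_
    rw [Finset.card_univ]
    refine (Fintype.card_subtype_le _).trans ?_
    rw [Fintype.card_finset]
    exact Nat.pow_le_pow_right (by norm_num)
      (Fintype.card_le_of_surjective (Quotient.mk (SameCycle.setoid f)) Quotient.mk_surjective)

lemma exists_comp_perm_eq [Fintype α] {β : Type*} [DecidableEq β] {f g : α → β}
    (h : ∀ b, (Finset.univ.filter fun a => f a = b).card =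
      (Finset.univ.filter fun a => g a = b).card) : ∃ s : Equiv.Perm α, g ∘ s = f := by
  have h' : ∀ b, Nonempty ({a // f a = b} ≃ {a // g a = b}) := fun b =>
    Fintype.card_eq.1 (by rw [Fintype.card_subtype, Fintype.card_subtype, h])
  let e := fun b => (h' b).some
  refine ⟨(Equiv.sigmaFiberEquiv f).symm.trans
    ((Equiv.sigmaCongrRight e).trans (Equiv.sigmaFiberEquiv g)), funext fun a => ?_⟩
  exact (e (f a) ⟨a, rfl⟩).2

/-- Counting colourings invariant under a permutation, summed over all permutations. -/
lemma sum_card_comp_eq_le (α β : Type*) [Fintype α] [DecidableEq α] [Fintype β] :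
    ∑ s : Equiv.Perm α, Nat.card {f : α → β // f ∘ s = f}
      ≤ (Fintype.card β).multichoose (Fintype.card α) * (Fintype.card α).factorial := by
  classical
  have : Fintype (MulAction.orbitRel.Quotient (Equiv.Perm α)ᵈᵐᵃ (α → β)) := Fintype.ofFinite _
  have : Fintype (Equiv.Perm α)ᵈᵐᵃ := Fintype.ofEquiv _ DomMulAct.mk
  have hb := MulAction.sum_card_fixedBy_eq_card_orbits_mul_card_group (Equiv.Perm α)ᵈᵐᵃ (α → β)
  rw [← DomMulAct.mk.sum_comp, ← Fintype.card_congr (DomMulAct.mk (M := Equiv.Perm α)),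
    Fintype.card_perm] at hb
  refine (le_of_eq ?_).trans (hb.le.trans (Nat.mul_le_mul_right _ ?_))
  · refine Finset.sum_congr rfl fun s _ => ?_
    rw [← Nat.card_eq_fintype_card]
    rfl
  · let F : (α → β) → Sym β (Fintype.card α) := fun f =>
      ⟨Finset.univ.val.map f, by rw [Multiset.card_map]; rfl⟩
    rw [← Sym.card_sym_eq_multichoose]
    refine Fintype.card_le_of_injective
      (fun o : MulAction.orbitRel.Quotient (Equiv.Perm α)ᵈᵐᵃ (α → β) => F o.out) ?_
    intro o₁ o₂ h
    rw [← Quotient.out_eq o₁, ← Quotient.out_eq o₂]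
    refine Quotient.sound ?_
    have h' : Finset.univ.val.map o₁.out = Finset.univ.val.map o₂.out := congrArg Subtype.val h
    obtain ⟨s, hs⟩ := exists_comp_perm_eq (f := o₁.out) (g := o₂.out) fun b => by
      have := congrArg (Multiset.count b) h'
      rw [Multiset.count_map, Multiset.count_map] at this
      simp only [Finset.card_def, Finset.filter_val]
      simpa [eq_comm] using this
    exact ⟨DomMulAct.mk s, hs⟩

end Counting

open Equiv.Perm

/-- The data of a permutation of `Fin (2 * n) × Fin 3` preserving the fibres of the first
projection. -/
abbrev FibrePerm (n : ℕ) : Type :=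
  Equiv.Perm (Fin (2 * n)) × (Fin (2 * n) → Equiv.Perm (Fin 3))

/-- The permutation described by such data. -/
abbrev FibrePerm.toPerm {n : ℕ} (s : FibrePerm n) : Equiv.Perm (Fin (2 * n) × Fin 3) :=
  Equiv.prodShear s.1 s.2

namespace FibrePerm

variable {n : ℕ}

lemma toPerm_injective : Function.Injective (toPerm (n := n)) := by
  rintro ⟨s, c⟩ ⟨s', c'⟩ h
  have h' : ∀ v j, s v = s' v ∧ c v j = c' v j := fun v j =>
    Prod.mk.injEq _ _ _ _ ▸ DFunLike.congr_fun h (v, j)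
  rw [Equiv.ext fun v => (h' v 0).1, funext fun v => Equiv.ext fun j => (h' v j).2]

lemma exists_toPerm_eq (f : Equiv.Perm (Fin (2 * n) × Fin 3))
    (hf : ∀ a b, a.1 = b.1 ↔ (f a).1 = (f b).1) : ∃ s : FibrePerm n, s.toPerm = f := by
  have h1 : Function.Injective fun v => (f (v, 0)).1 := fun v w h => (hf (v, 0) (w, 0)).2 h
  have h2 : ∀ v, Function.Injective fun j => (f (v, j)).2 := by
    intro v i j h
    exact congrArg Prod.snd (f.injective (Prod.ext ((hf (v, i) (v, j)).1 rfl) h))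
  refine ⟨⟨Equiv.ofBijective _ (Finite.injective_iff_bijective.1 h1),
    fun v => Equiv.ofBijective _ (Finite.injective_iff_bijective.1 (h2 v))⟩, ?_⟩
  ext1 ⟨v, j⟩
  exact Prod.ext ((hf (v, 0) (v, j)).1 rfl) rfl

lemma fst_zpow_toPerm (s : FibrePerm n) (i : ℤ) (d : Fin (2 * n) × Fin 3) :
    ((s.toPerm ^ i) d).1 = (s.1 ^ i) d.1 := by
  have hpow : ∀ (k : ℕ) (d : Fin (2 * n) × Fin 3), ((s.toPerm ^ k) d).1 = (s.1 ^ k) d.1 := by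
    intro k
    induction k with
    | zero => exact fun _ => rfl
    | succ k ih =>
      intro d
      rw [pow_succ, pow_succ, Equiv.Perm.mul_apply, Equiv.Perm.mul_apply, ih]
      rfl
  obtain ⟨k, rfl | rfl⟩ := i.eq_nat_or_neg
  · simpa using hpow k d
  · rw [zpow_neg, zpow_neg, zpow_natCast, zpow_natCast, Equiv.Perm.eq_inv_iff_eq, ← hpow]
    exact congrArg Prod.fst ((s.toPerm ^ k).apply_symm_apply d)

lemma card_cycleSpace_toPerm_le (s : FibrePerm n) :
    Nat.card (CycleSpace s.toPerm) ≤ Nat.card (CycleSpace s.1) * 3 := by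
  have := Nat.card_le_card_of_surjective
    (fun p : CycleSpace s.1 × Fin 3 => (⟦(p.1.out, p.2)⟧ : CycleSpace s.toPerm)) ?_
  · simpa [Nat.card_prod] using this
  intro o
  induction o using Quotient.inductionOn with
  | h d =>
    obtain ⟨i, hi⟩ : SameCycle s.1 d.1 (Quotient.out (⟦d.1⟧ : CycleSpace s.1)) :=
      (Quotient.exact (s := SameCycle.setoid s.1) (Quotient.out_eq (⟦d.1⟧ : CycleSpace s.1))).symm
    refine ⟨(⟦d.1⟧, ((s.toPerm ^ i) d).2), Quotient.sound ?_⟩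
    refine SameCycle.symm ⟨i, Prod.ext ?_ rfl⟩
    rw [fst_zpow_toPerm, hi]

end FibrePerm

lemma pow_card_cycleSpace_le {α β : Type*} [Finite α] [Fintype β] (s : Equiv.Perm α) :
    Fintype.card β ^ Nat.card (CycleSpace s) ≤ Nat.card {f : α → β // f ∘ s = f} := by
  classical
  have : Fintype α := Fintype.ofFinite _
  have : Fintype (CycleSpace s) := Fintype.ofFinite _
  rw [Nat.card_eq_fintype_card, ← Fintype.card_fun, ← Nat.card_eq_fintype_card]
  refine Nat.card_le_card_of_injective
    (fun h : CycleSpace s → β => (⟨fun a => h ⟦a⟧, funext fun a => congrArg h (Quotient.sound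
      (sameCycle_apply_left.2 (SameCycle.refl _ _)))⟩ : {f : α → β // f ∘ s = f})) ?_
  intro h h' e
  funext o
  induction o using Quotient.inductionOn with
  | h a => exact congrFun (congrArg Subtype.val e) a

/-- Pairs of a fibre-preserving permutation of the standard darts with fewer than `5 * n` fixed
points and a matching of these darts invariant under it. -/
abbrev BadPair (n : ℕ) : Type :=
  Σ s : {s : FibrePerm n // (Finset.univ.filter fun d => s.toPerm d = d).card < 5 * n},
    CommMatching s.1.toPerm

lemma card_badPair_le {n : ℕ} (hn : 1 ≤ n) :
    Nat.card (BadPair n)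
      ≤ 2 ^ (14 * n) * (6 * n) ^ (11 * n / 12) * Fintype.card (FibrePerm n) := by
  classical
  have : Nonempty (Fin (2 * n) × Fin 3) := ⟨(⟨0, by omega⟩, 0)⟩
  have hD : Fintype.card (Fin (2 * n) × Fin 3) = 6 * n := by
    rw [Fintype.card_prod, Fintype.card_fin, Fintype.card_fin]; ring
  have h1 : ∀ s : {s : FibrePerm n // (Finset.univ.filter fun d => s.toPerm d = d).card < 5 * n},
      Nat.card (CommMatching s.1.toPerm) ≤ 2 ^ (6 * n) * (6 * n) ^ (11 * n / 12) *
        Nat.card {f : Fin (2 * n) → Fin (6 * n) // f ∘ s.1.1 = f} := by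
    intro s
    have h2 := card_commMatching_le s.1.toPerm
    have h3 := card_cycleSpace_mul_two_le s.1.toPerm
    have h4 := s.1.card_cycleSpace_toPerm_le
    have h5 := pow_card_cycleSpace_le (β := Fin (6 * n)) s.1.1
    have h6 := s.2
    rw [hD] at h2 h3
    rw [Fintype.card_fin] at h5
    refine h2.trans ?_
    rw [mul_assoc]
    refine Nat.mul_le_mul_left _ (le_trans ?_ (Nat.mul_le_mul_left _ h5))
    rw [← pow_add]
    exact Nat.pow_le_pow_right (by omega) (by omega)
  have h2 : ∑ s : FibrePerm n, Nat.card {f : Fin (2 * n) → Fin (6 * n) // f ∘ s.1 = f}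
      ≤ 2 ^ (8 * n) * Fintype.card (FibrePerm n) := by
    rw [Fintype.sum_prod_type]
    simp only [Finset.sum_const, Finset.card_univ, smul_eq_mul]
    rw [← Finset.mul_sum, Fintype.card_prod, Fintype.card_perm, ← mul_assoc, mul_comm]
    refine Nat.mul_le_mul_right _ ((sum_card_comp_eq_le _ _).trans (Nat.mul_le_mul_right _ ?_))
    rw [Nat.multichoose_eq]
    refine (Nat.choose_le_two_pow _ _).trans (Nat.pow_le_pow_right (by norm_num) ?_)
    simp only [Fintype.card_fin]
    omega
  rw [Nat.card_sigma]
  refine (Finset.sum_le_sum fun s _ => h1 s).trans ?_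
  rw [← Finset.mul_sum]
  have h3 : ∑ s : {s : FibrePerm n // (Finset.univ.filter fun d => s.toPerm d = d).card < 5 * n},
      Nat.card {f : Fin (2 * n) → Fin (6 * n) // f ∘ s.1.1 = f} ≤
      ∑ s : FibrePerm n, Nat.card {f : Fin (2 * n) → Fin (6 * n) // f ∘ s.1 = f} := by
    rw [← Finset.sum_subtype (Finset.univ.filter fun s : FibrePerm n =>
      (Finset.univ.filter fun d => s.toPerm d = d).card < 5 * n) (by simp)
      fun s : FibrePerm n => Nat.card {f : Fin (2 * n) → Fin (6 * n) // f ∘ s.1 = f}]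
    exact Finset.sum_le_sum_of_subset (Finset.filter_subset _ _)
  refine (Nat.mul_le_mul_left _ (h3.trans h2)).trans_eq ?_
  rw [show 14 * n = 6 * n + 8 * n by ring, pow_add]
  ring

namespace CubicGraph

variable {n : ℕ}

lemma exists_labelling (g : CubicGraph n) : ∃ t : Fin (6 * n) ≃ Fin (2 * n) × Fin 3,
    ∀ d, (t d).1 = g.vert d := by
  have h : ∀ v, Nonempty ({d // g.vert d = v} ≃ Fin 3) := fun v => Fintype.card_eq.1 (by
    rw [Fintype.card_subtype, g.regular, Fintype.card_fin])
  let e := fun v => (h v).some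
  exact ⟨(Equiv.sigmaFiberEquiv g.vert).symm.trans
    ((Equiv.sigmaCongrRight e).trans (Equiv.sigmaEquivProd _ _)), fun d => rfl⟩

/-- Automorphisms fixing fewer than `5 * n` darts. -/
abbrev BadAut (g : CubicGraph n) : Type :=
  {f : g.autGroup // (Finset.univ.filter fun d => f.1 d = d).card < 5 * n}

lemma mul_card_autGroup_le (g : CubicGraph n) :
    5 * n * Nat.card g.autGroup
      ≤ Nat.card g.DartOrbits * Nat.card g.autGroup + 5 * n * Nat.card g.BadAut := by
  classical
  have : Fintype g.DartOrbits := Fintype.ofFinite _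
  have hb := MulAction.sum_card_fixedBy_eq_card_orbits_mul_card_group g.autGroup (Fin (6 * n))
  have hbad : Nat.card g.BadAut = ∑ f : g.autGroup,
      if (Finset.univ.filter fun d => f.1 d = d).card < 5 * n then 1 else 0 := by
    rw [Nat.card_eq_fintype_card, Fintype.card_subtype, Finset.card_filter]
  have hall : 5 * n * Nat.card g.autGroup = ∑ _f : g.autGroup, 5 * n := by
    rw [Finset.sum_const, Finset.card_univ, smul_eq_mul, mul_comm, Nat.card_eq_fintype_card]
  have horb : Nat.card g.DartOrbits * Nat.card g.autGroup =
      ∑ f : g.autGroup, Fintype.card (MulAction.fixedBy (Fin (6 * n)) f) := by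
    rw [hb, Nat.card_eq_fintype_card, Nat.card_eq_fintype_card]
  rw [hbad, hall, horb, Finset.mul_sum, ← Finset.sum_add_distrib]
  refine Finset.sum_le_sum fun f _ => ?_
  have : Fintype.card (MulAction.fixedBy (Fin (6 * n)) f) =
      (Finset.univ.filter fun d => f.1 d = d).card := by
    rw [Fintype.card_subtype]
    rfl
  rw [this]
  split_ifs <;> omega

/-- The labellings of the darts of `g` by standard darts that turn the edge involution
into `m`. -/
abbrev Labelling (g : CubicGraph n) (m : Fin (2 * n) × Fin 3 → Fin (2 * n) × Fin 3) : Type :=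
  {t : Fin (6 * n) ≃ Fin (2 * n) × Fin 3 //
    (∀ a b, g.vert a = g.vert b ↔ (t a).1 = (t b).1) ∧ ∀ d, m (t d) = t (g.dinv d)}

lemma Labelling.isDartIso {g₁ g₂ : CubicGraph n}
    {m : Fin (2 * n) × Fin 3 → Fin (2 * n) × Fin 3}
    (t₁ : g₁.Labelling m) (t₂ : g₂.Labelling m) : IsDartIso g₁ g₂ (t₁.1.trans t₂.1.symm) := by
  refine ⟨fun d => ?_, fun a b => ?_⟩
  · apply t₂.1.injective
    rw [← t₂.2.2]
    simp [t₁.2.2]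
  · rw [t₁.2.1, t₂.2.1]
    simp

/-- The bad pairs whose matching comes from `g`. -/
abbrev BadPairOf (g : CubicGraph n) : Type := {p : BadPair n // Nonempty (g.Labelling p.2.1)}

lemma card_fibrePerm_mul_card_badAut_le (g : CubicGraph n) :
    Fintype.card (FibrePerm n) * Nat.card g.BadAut
      ≤ Nat.card g.autGroup * Nat.card g.BadPairOf := by
  obtain ⟨t, ht⟩ := g.exists_labelling
  let T : FibrePerm n → (Fin (6 * n) ≃ Fin (2 * n) × Fin 3) := fun s => t.trans s.toPerm
  have hT : ∀ s a b, g.vert a = g.vert b ↔ (T s a).1 = (T s b).1 := by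
    intro s a b
    rw [← ht, ← ht]
    exact s.1.injective.eq_iff.symm
  have hex : ∀ (s : FibrePerm n) (f : g.BadAut), ∃ p : BadPair n,
      p.1.1.toPerm = ((T s).symm.trans f.1.1).trans (T s) ∧
      p.2.1 = fun d => T s (g.dinv ((T s).symm d)) := by
    intro s f
    have hf : IsDartIso g g f.1.1 := f.1.2
    obtain ⟨s', hs'⟩ := FibrePerm.exists_toPerm_eq (((T s).symm.trans f.1.1).trans (T s)) (by
      intro a b
      have h1 := hT s ((T s).symm a) ((T s).symm b)
      rw [Equiv.apply_symm_apply, Equiv.apply_symm_apply] at h1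
      rw [← h1, hf.2, hT s]
      rfl)
    refine ⟨⟨⟨s', ?_⟩, ⟨fun d => T s (g.dinv ((T s).symm d)), ?_, ?_, ?_⟩⟩, hs', rfl⟩
    · refine lt_of_eq_of_lt ?_ f.2
      refine Finset.card_equiv (T s).symm fun d => ?_
      rw [Finset.mem_filter_univ, Finset.mem_filter_univ, hs']
      exact Equiv.eq_symm_apply (T s) |>.symm
    · intro d; simp [g.dinv_invol]
    · intro d h
      rw [← Equiv.eq_symm_apply] at h
      exact g.dinv_ne _ h
    · intro d
      rw [hs']
      simp [hf.1]
  choose p hp1 hp2 using hex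
  have hlab : ∀ s f, Nonempty (g.Labelling (p s f).2.1) := fun s f =>
    ⟨⟨T s, hT s, fun d => by rw [hp2]; simp⟩⟩
  rw [← Nat.card_eq_fintype_card, ← Nat.card_prod, ← Nat.card_prod]
  let L : ∀ q : g.BadPairOf, g.Labelling q.1.2.1 := fun q => q.2.some
  refine Nat.card_le_card_of_injective
    (fun x : FibrePerm n × g.BadAut => ((⟨(T x.1).trans (L ⟨p x.1 x.2, hlab x.1 x.2⟩).1.symm,
      Labelling.isDartIso ⟨T x.1, hT x.1, fun d => by rw [hp2]; simp⟩
        (L ⟨p x.1 x.2, hlab x.1 x.2⟩)⟩, ⟨p x.1 x.2, hlab x.1 x.2⟩) :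
        g.autGroup × g.BadPairOf)) ?_
  rintro ⟨s₁, f₁⟩ ⟨s₂, f₂⟩ h
  rw [Prod.mk.injEq] at h
  obtain ⟨h1, h2⟩ := h
  have hTT : T s₁ = T s₂ := by
    ext1 d
    have h3 := DFunLike.congr_fun (congrArg Subtype.val h1) d
    have h4 : ∀ q q' : g.BadPairOf, q = q' → (L q).1 = (L q').1 := by rintro q _ rfl; rfl
    have h5 : (L ⟨p s₁ f₁, hlab s₁ f₁⟩).1.symm (T s₁ d) =
      (L ⟨p s₂ f₂, hlab s₂ f₂⟩).1.symm (T s₂ d) := h3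
    rw [h4 _ _ h2] at h5
    exact (Equiv.injective _) h5
  have hs : s₁ = s₂ := by
    refine FibrePerm.toPerm_injective (Equiv.ext fun d => ?_)
    have := DFunLike.congr_fun hTT (t.symm d)
    simpa [T] using this
  subst hs
  have hpp : p s₁ f₁ = p s₁ f₂ := congrArg Subtype.val h2
  have hff := (hp1 s₁ f₁).symm.trans ((congrArg (fun q : BadPair n => q.1.1.toPerm) hpp).trans
    (hp1 s₁ f₂))
  have : f₁ = f₂ := by
    refine Subtype.ext (Subtype.ext (Equiv.ext fun d => ?_))
    have := DFunLike.congr_fun hff (T s₁ d)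
    simpa using this
  rw [this]

end CubicGraph

open CubicGraph

lemma five_mul_card_le {n : ℕ} (hn : 1 ≤ n) :
    5 * (Nat.card ((bridgedSet n)ᶜ : Set (GammaV n)) : ℝ)
      ≤ 3 * Nat.card (bridgedSet n) + 5 * (2 ^ (14 * n) * (6 * n) ^ (11 * n / 12)) := by
  classical
  have : Fintype ((bridgedSet n)ᶜ : Set (GammaV n)) := Fintype.ofFinite _
  let g : ((bridgedSet n)ᶜ : Set (GammaV n)) → CubicGraph n := fun u => (Quot.out u.1).1
  have hG : (0 : ℝ) < Fintype.card (FibrePerm n) := by exact_mod_cast Fintype.card_pos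
  have ha : ∀ u, (0 : ℝ) < Nat.card (g u).autGroup := fun u => by exact_mod_cast Nat.card_pos
  have h1 : ∀ u, 5 * (n : ℝ) ≤ Nat.card (g u).DartOrbits +
      5 * n * (Nat.card (g u).BadPairOf / Fintype.card (FibrePerm n)) := by
    intro u
    have e1 : 5 * (n : ℝ) * Nat.card (g u).autGroup ≤ Nat.card (g u).DartOrbits *
        Nat.card (g u).autGroup + 5 * n * Nat.card (g u).BadAut := by
      exact_mod_cast (g u).mul_card_autGroup_le
    have e2 : (Fintype.card (FibrePerm n) : ℝ) * Nat.card (g u).BadAut ≤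
        Nat.card (g u).autGroup * Nat.card (g u).BadPairOf := by
      exact_mod_cast (g u).card_fibrePerm_mul_card_badAut_le
    have e3 : (Nat.card (g u).BadAut : ℝ) ≤
        Nat.card (g u).autGroup * (Nat.card (g u).BadPairOf / Fintype.card (FibrePerm n)) := by
      rw [← mul_div_assoc, le_div_iff₀ hG, mul_comm]
      exact e2
    refine le_of_mul_le_mul_right (e1.trans ?_) (ha u)
    have := mul_le_mul_of_nonneg_left e3 (by positivity : (0 : ℝ) ≤ 5 * n)
    linarith
  have h2 : ∑ u, (Nat.card (g u).BadPairOf : ℝ) ≤ Nat.card (BadPair n) := by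
    have : Nat.card (Σ u, (g u).BadPairOf) ≤ Nat.card (BadPair n) := by
      refine Nat.card_le_card_of_injective (fun p => p.2.1) ?_
      rintro ⟨u, p, ⟨t⟩⟩ ⟨u', p', ⟨t'⟩⟩ h
      dsimp only at h
      subst h
      have : u = u' := Subtype.ext (gammaV_eq (isIsomorphic_iff.2 ⟨_, Labelling.isDartIso t t'⟩))
      subst this
      rfl
    rw [Nat.card_sigma] at this
    exact_mod_cast this
  have h3 : (∑ u, (Nat.card (g u).DartOrbits : ℝ)) * 2 ≤ Nat.card (bridgedSet n) * (6 * n) := by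
    have := sum_card_dartOrbits_le n
    rw [Nat.card_sigma] at this
    exact_mod_cast this
  have h4 := Finset.sum_le_sum fun u (_ : u ∈ Finset.univ) => h1 u
  rw [Finset.sum_add_distrib, ← Finset.mul_sum Finset.univ _ (5 * (n : ℝ)), ← Finset.sum_div,
    Finset.sum_const, nsmul_eq_mul, Finset.card_univ, ← Nat.card_eq_fintype_card] at h4
  have h5 : (∑ u, (Nat.card (g u).BadPairOf : ℝ)) / Fintype.card (FibrePerm n) ≤
      2 ^ (14 * n) * (6 * n) ^ (11 * n / 12) := by
    rw [div_le_iff₀ hG]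
    refine h2.trans ?_
    exact_mod_cast card_badPair_le hn
  have hn' : (0 : ℝ) < n := by exact_mod_cast hn
  have h6 := mul_le_mul_of_nonneg_left h5 (by positivity : (0 : ℝ) ≤ 5 * n)
  refine le_of_mul_le_mul_right ?_ hn'
  linarith

namespace CubicGraph

variable {n : ℕ} {W : Type*}

/-- `p` identifies `g` with the cubic graph on `W` whose edges join `v` to `s v` and to `c v`. -/
structure IsPermModel (g : CubicGraph n) (s : Equiv.Perm W) (c : W → W)
    (p : W × Fin 3 ≃ Fin (6 * n)) : Prop where
  vert_eq_iff : ∀ a b, g.vert (p a) = g.vert (p b) ↔ a.1 = b.1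
  dinv_zero : ∀ v, g.dinv (p (v, 0)) = p (s v, 1)
  dinv_two : ∀ v, g.dinv (p (v, 2)) = p (c v, 2)

lemma exists_isPermModel [Fintype W] (hW : Fintype.card W = 2 * n) (s : Equiv.Perm W) {c : W → W}
    (hc : ∀ v, c (c v) = v) (hc' : ∀ v, c v ≠ v) :
    ∃ (g : CubicGraph n) (p : _), g.IsPermModel s c p := by
  classical
  let e : W ≃ Fin (2 * n) := Fintype.equivFinOfCardEq hW
  let p : W × Fin 3 ≃ Fin (6 * n) := Fintype.equivFinOfCardEq (by
    rw [Fintype.card_prod, hW, Fintype.card_fin]; ring)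
  let m : W × Fin 3 → W × Fin 3 := fun a =>
    if a.2 = 0 then (s a.1, 1) else if a.2 = 1 then (s.symm a.1, 0) else (c a.1, 2)
  have h3 : ∀ j : Fin 3, j = 0 ∨ j = 1 ∨ j = 2 := by decide
  have hm : ∀ a, m (m a) = a := by
    rintro ⟨v, j⟩
    rcases h3 j with rfl | rfl | rfl <;> simp [m, hc]
  have hm' : ∀ a, m a ≠ a := by
    rintro ⟨v, j⟩
    rcases h3 j with rfl | rfl | rfl <;> simp [m, hc']
  refine ⟨⟨fun d => e (p.symm d).1, fun d => p (m (p.symm d)), fun d => by simp [hm],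
    fun d h => hm' (p.symm d) (by rw [Equiv.eq_symm_apply]; exact h), fun v => ?_⟩, p, ?_, ?_, ?_⟩
  · rw [← Fintype.card_subtype]
    refine (Fintype.card_congr ⟨fun d => (p.symm d.1).2, fun j => ⟨p (e.symm v, j), by simp⟩,
      ?_, fun j => ?_⟩).trans (Fintype.card_fin 3)
    · rintro ⟨d, rfl⟩
      simp
    · simp
  · intro a b; simp
  · intro v; simp [m]
  · intro v; simp [m]

namespace IsPermModel

variable {g : CubicGraph n} {s : Equiv.Perm W} {c : W → W} {p : W × Fin 3 ≃ Fin (6 * n)}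

lemma trans_isDartIso (h : g.IsPermModel s c p) {g' : CubicGraph n}
    {f : Equiv.Perm (Fin (6 * n))} (hf : IsDartIso g g' f) : g'.IsPermModel s c (p.trans f) where
  vert_eq_iff a b := by rw [← h.vert_eq_iff, hf.2]; rfl
  dinv_zero v := (hf.1 _).trans (congrArg f (h.dinv_zero v))
  dinv_two v := (hf.1 _).trans (congrArg f (h.dinv_two v))

lemma reach_perm (h : g.IsPermModel s c p) (v : W) (i j : Fin 3) :
    g.Reach (p (v, i)) (p (s v, j)) :=
  (reach_of_vert_eq ((h.vert_eq_iff (v, i) (v, 0)).2 rfl)).trans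
    ((reach_dinv g _).trans (by
      rw [h.dinv_zero]; exact reach_of_vert_eq ((h.vert_eq_iff _ _).2 rfl)))

lemma reach_matching (h : g.IsPermModel s c p) (v : W) (i j : Fin 3) :
    g.Reach (p (v, i)) (p (c v, j)) :=
  (reach_of_vert_eq ((h.vert_eq_iff (v, i) (v, 2)).2 rfl)).trans
    ((reach_dinv g _).trans (by
      rw [h.dinv_two]; exact reach_of_vert_eq ((h.vert_eq_iff _ _).2 rfl)))

lemma reachAvoiding_of_transitive (h : g.IsPermModel s c p)
    (hs : ∀ v w, ∃ k : ℕ, (s ^ k) v = w) (x a b : Fin (6 * n)) : g.ReachAvoiding x a b := by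
  have h3 : ∀ j : Fin 3, j = 0 ∨ j = 1 ∨ j = 2 := by decide
  obtain ⟨v₀, hv₀⟩ : ∃ v₀, ∀ v, v ≠ v₀ → p (v, 0) ≠ x ∧ p (v, 0) ≠ g.dinv x := by
    obtain ⟨⟨w, j⟩, rfl⟩ := p.surjective x
    rcases h3 j with rfl | rfl | rfl
    · refine ⟨w, fun v hv => ⟨by simpa using hv, ?_⟩⟩
      rw [h.dinv_zero]
      simp
    · refine ⟨s.symm w, fun v hv => ⟨by simp, ?_⟩⟩
      have := h.dinv_zero (s.symm w)
      rw [s.apply_symm_apply] at this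
      rw [← this, g.dinv_invol]
      simpa using hv
    · refine ⟨w, fun v hv => ⟨by simp, ?_⟩⟩
      rw [h.dinv_two]
      simp
  have hstep : ∀ k : ℕ, g.ReachAvoiding x (p (s v₀, 0)) (p ((s ^ k) (s v₀), 0)) := by
    intro k
    induction k with
    | zero => exact Relation.ReflTransGen.refl
    | succ k ih =>
      rw [pow_succ', Equiv.Perm.mul_apply]
      by_cases hk : (s ^ k) (s v₀) = v₀
      · rw [hk]; exact Relation.ReflTransGen.refl
      · obtain ⟨h1, h2⟩ := hv₀ _ hk
        refine ih.trans ((reachAvoiding_dinv h1 h2).trans ?_)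
        rw [h.dinv_zero]
        exact reachAvoiding_of_vert_eq ((h.vert_eq_iff _ _).2 rfl)
  have hall : ∀ a, g.ReachAvoiding x (p (s v₀, 0)) a := by
    intro a
    obtain ⟨⟨w, j⟩, rfl⟩ := p.surjective a
    obtain ⟨k, rfl⟩ := hs (s v₀) w
    exact (hstep k).trans (reachAvoiding_of_vert_eq ((h.vert_eq_iff _ _).2 rfl))
  exact (hall a).symm.trans (hall b)

/-- Two models of the same graph along a transitive permutation of `S` that start at the same
dart and turn at every vertex in the same direction have the same chords within `S`. -/
lemma matching_eq {c' : W → W} {p' : W × Fin 3 ≃ Fin (6 * n)} (h : g.IsPermModel s c p)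
    (h' : g.IsPermModel s c' p') {z : W} (hz : p (z, 0) = p' (z, 0))
    (hb : ∀ v, p (v, 0) = g.oMin (p (v, 1)) ↔ p' (v, 0) = g.oMin (p' (v, 1)))
    {v : W} (hv : ∃ k : ℕ, (s ^ k) z = v) (hcv : ∃ k : ℕ, (s ^ k) z = c v)
    (hs : ∃ k : ℕ, 0 < k ∧ (s ^ k) z = z) : c v = c' v := by
  have hthird : ∀ {p : W × Fin 3 ≃ Fin (6 * n)} {c : W → W}, g.IsPermModel s c p → ∀ v i j,
      i ≠ j → p (v, i) = g.oMin (p (v, j)) ∨ p (v, i) = g.oMax (p (v, j)) := by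
    intro p c h v i j hij
    rcases eq_or_eq_oMin_or_eq_oMax ((h.vert_eq_iff (v, i) (v, j)).2 rfl) with e | e
    · exact absurd (congrArg Prod.snd (p.injective e)) hij
    · exact e
  have hone : ∀ v, p (v, 0) = p' (v, 0) → p (s v, 1) = p' (s v, 1) := by
    intro v hv
    rw [← h.dinv_zero, ← h'.dinv_zero, hv]
  have hzero : ∀ v, p (v, 1) = p' (v, 1) → p (v, 0) = p' (v, 0) := by
    intro v hv
    by_cases hm : p (v, 0) = g.oMin (p (v, 1))
    · rw [hm, (hb v).1 hm, hv]
    · rw [(hthird h v 0 1 (by decide)).resolve_left hm,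
        (hthird h' v 0 1 (by decide)).resolve_left fun e => hm ((hb v).2 e), hv]
  have hall : ∀ k : ℕ, p ((s ^ k) z, 0) = p' ((s ^ k) z, 0) := by
    intro k
    induction k with
    | zero => exact hz
    | succ k ih =>
      rw [pow_succ', Equiv.Perm.mul_apply]
      exact hzero _ (hone _ ih)
  have hall1 : ∀ k : ℕ, p ((s ^ k) z, 1) = p' ((s ^ k) z, 1) := by
    intro k
    obtain ⟨l, hl, hlz⟩ := hs
    have : (s ^ k) z = s ((s ^ (k + (l - 1))) z) := by
      rw [← Equiv.Perm.mul_apply, ← pow_succ', show k + (l - 1) + 1 = k + l by omega, pow_add,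
        Equiv.Perm.mul_apply, hlz]
    rw [this]
    exact hone _ (hall _)
  have hall2 : ∀ v, (∃ k : ℕ, (s ^ k) z = v) → p (v, 2) = p' (v, 2) := by
    rintro _ ⟨k, rfl⟩
    generalize hv : (s ^ k) z = v
    have h0 := hall k
    have h1 := hall1 k
    rw [hv] at h0 h1
    have e : g.vert (p' (v, 2)) = g.vert (p (v, 0)) := by rw [h0, h'.vert_eq_iff]
    rcases eq_of_vert_eq (a := p (v, 0)) (b := p (v, 1)) (c := p (v, 2)) (by simp) (by simp)
      (by simp) ((h.vert_eq_iff _ _).2 rfl) ((h.vert_eq_iff _ _).2 rfl) e with e | e | e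
    · rw [h0] at e; simp at e
    · rw [h1] at e; simp at e
    · exact e.symm
  have h2 : p' (c v, 2) = p' (c' v, 2) := by
    rw [← hall2 _ hcv, ← h.dinv_two, ← h'.dinv_two, hall2 _ hv]
  exact congrArg Prod.fst (p'.injective h2)

end IsPermModel

lemma exists_transitive_perm (α : Type*) [Fintype α] :
    ∃ r : Equiv.Perm α, ∀ x y, ∃ k : ℕ, (r ^ k) x = y := by
  classical
  obtain ⟨r, hr, -⟩ := (Finset.univ : Finset α).exists_cycleOn
  exact ⟨r, fun x y => hr.exists_pow_eq (Finset.mem_univ x) (Finset.mem_univ y) |>.imp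
    fun k hk => hk.2⟩

end CubicGraph

open CubicGraph

lemma bridgedSet_compl_nonempty (n : ℕ) : ((bridgedSet n)ᶜ).Nonempty := by
  obtain ⟨r, hr⟩ := exists_transitive_perm (Fin n × Bool)
  obtain ⟨g, p, hp⟩ := exists_isPermModel (n := n) (by simp [mul_comm]) r
    (c := fun v : Fin n × Bool => (v.1, !v.2)) (by simp) (by simp [Prod.ext_iff])
  have h := hp.reachAvoiding_of_transitive hr
  have hg : g.Connected := fun a b => reach_of_reachAvoiding (h a a b)
  exact ⟨_, mk_notMem_bridgedSet hg fun ⟨x, hx⟩ => hx (h x)⟩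

/-- The matching on `Option (Option (ι × Bool))` joining the two extra points and pairing
`(i, true)` with `(t i, false)`. -/
def pairing {ι : Type*} (t : Equiv.Perm ι) : Option (Option (ι × Bool)) → Option (Option (ι × Bool))
  | none => some none
  | some none => none
  | some (some (i, true)) => some (some (t i, false))
  | some (some (i, false)) => some (some (t.symm i, true))

lemma pairing_pairing {ι : Type*} (t : Equiv.Perm ι) (v : Option (Option (ι × Bool))) :
    pairing t (pairing t v) = v := by
  rcases v with _ | _ | ⟨i, _ | _⟩ <;> simp [pairing]

lemma pairing_ne {ι : Type*} (t : Equiv.Perm ι) (v : Option (Option (ι × Bool))) :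
    pairing t v ≠ v := by
  rcases v with _ | _ | ⟨i, _ | _⟩ <;> simp [pairing]

/-- There are many bridged cubic graphs. -/
lemma factorial_le_card_bridgedSet (k : ℕ) :
    k.factorial ≤ Nat.card (bridgedSet (k + 1)) * (6 * (k + 1)) * 4 ^ (k + 1) := by
  classical
  have hW : Fintype.card (Option (Option (Fin k × Bool))) = 2 * (k + 1) := by
    simp; ring
  obtain ⟨r, hr⟩ := exists_transitive_perm (Option (Fin k × Bool))
  let s : Equiv.Perm (Option (Option (Fin k × Bool))) := r.optionCongr
  have hs : ∀ (x : Option (Fin k × Bool)) (l : ℕ), (s ^ l) (some x) = some ((r ^ l) x) := by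
    intro x l
    induction l with
    | zero => rfl
    | succ l ih => rw [pow_succ', pow_succ', Equiv.Perm.mul_apply, ih]; rfl
  have hs' : ∀ x : Option (Fin k × Bool), ∃ l : ℕ, (s ^ l) (some none) = some x := fun x =>
    (hr none x).imp fun l hl => by rw [hs, hl]
  have hex : ∀ t : Equiv.Perm (Fin k), ∃ (u : bridgedSet (k + 1)) (p : _),
      (Quot.out u.1).1.IsPermModel s (pairing t) p := by
    intro t
    obtain ⟨g, p, hp⟩ := exists_isPermModel hW s (pairing_pairing t) (pairing_ne t)
    have hreach : ∀ (l : ℕ) (x : Option (Fin k × Bool)),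
        g.Reach (p (some x, 0)) (p (some ((r ^ l) x), 0)) := by
      intro l x
      induction l with
      | zero => exact Relation.ReflTransGen.refl
      | succ l ih =>
        rw [pow_succ', Equiv.Perm.mul_apply]
        exact ih.trans (hp.reach_perm (some ((r ^ l) x)) 0 0)
    have hall : ∀ a, g.Reach (p (some none, 0)) a := by
      intro a
      obtain ⟨⟨_ | x, j⟩, rfl⟩ := p.surjective a
      · exact hp.reach_matching (some none) 0 j
      · obtain ⟨l, rfl⟩ := hr none x
        exact (hreach l none).trans (reach_of_vert_eq ((hp.vert_eq_iff _ _).2 rfl))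
    have hg : g.Connected := fun a b => (hall a).symm.trans (hall b)
    have hl : g.dinv (p (none, 0)) = p (none, 1) := hp.dinv_zero none
    have hloop : g.IsLoop (p (none, 0)) := by
      rw [IsLoop, hl]
      exact (hp.vert_eq_iff _ _).2 rfl
    have hb : g.IsBridge (p (none, 2)) := isBridge_of_isLoop hloop ((hp.vert_eq_iff _ _).2 rfl)
      (by simp) (by rw [hl]; simp)
    obtain ⟨f, hf⟩ := isIsomorphic_iff.1 (isIsomorphic_out g hg)
    exact ⟨⟨_, mk_mem_bridgedSet hg ⟨_, hb⟩⟩, _, hp.trans_isDartIso hf⟩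
  choose u p hp using hex
  have := Nat.card_le_card_of_injective (fun t : Equiv.Perm (Fin k) =>
    (((u t, p t (some none, 0)), fun v => decide (p t (v, 0) =
      (Quot.out (u t).1).1.oMin (p t (v, 1)))) :
      (bridgedSet (k + 1) × Fin (6 * (k + 1))) × (Option (Option (Fin k × Bool)) → Bool))) ?_
  · rw [Nat.card_prod, Nat.card_prod, Nat.card_eq_fintype_card (α := Equiv.Perm (Fin k)),
      Fintype.card_perm, Fintype.card_fin, Nat.card_eq_fintype_card (α := Fin (6 * (k + 1))),
      Fintype.card_fin, Nat.card_eq_fintype_card (α := _ → Bool), Fintype.card_fun, hW,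
      Fintype.card_bool, pow_mul] at this
    exact this
  intro t t' h
  simp only [Prod.mk.injEq] at h
  obtain ⟨⟨h1, h2⟩, h3⟩ := h
  have hp' := hp t'
  rw [← h1] at hp'
  refine Equiv.ext fun i => ?_
  have hloop : ∃ l : ℕ, 0 < l ∧ (s ^ l) (some none) = some none := by
    obtain ⟨l, hl⟩ := hr (r none) none
    refine ⟨l + 1, l.succ_pos, ?_⟩
    rw [hs, pow_succ, Equiv.Perm.mul_apply, hl]
  have := (hp t).matching_eq hp' h2 (fun v => by
    have := congrFun h3 v
    rw [← h1] at this
    exact decide_eq_decide.1 this) (v := some (some (i, true))) (hs' _) (hs' _) hloop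
  simpa [pairing] using this

section Asymptotics

lemma pow_self_le_factorial_mul (n : ℕ) : n ^ n ≤ n.factorial * 4 ^ n := by
  have h := Real.pow_div_factorial_le_exp (n : ℝ) n.cast_nonneg n
  have h4 : Real.exp n ≤ 4 ^ n := by
    rw [← mul_one (n : ℝ), Real.exp_nat_mul]
    exact pow_le_pow_left₀ (Real.exp_pos 1).le (by linarith [Real.exp_one_lt_d9]) n
  rw [div_le_iff₀ (by positivity)] at h
  have := h.trans (mul_le_mul_of_nonneg_right h4 (Nat.cast_nonneg _))
  rw [mul_comm]
  exact_mod_cast this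

lemma two_pow_mul_pow_le_pow_self {n : ℕ} (hn : 16 ^ 72 ≤ n) :
    5 * (2 ^ (14 * n) * (6 * n) ^ (11 * n / 12)) * (6 * n ^ 2 * 16 ^ n) ≤ 2 * n ^ n := by
  set q := 11 * n / 12 with hq
  obtain ⟨r, hr⟩ := Nat.exists_eq_add_of_le (show q ≤ n by omega)
  have hn4 : 4 ≤ n := le_trans (by norm_num) hn
  have hn0 : n ^ 2 ≤ 4 ^ n := by
    rw [show 4 = 2 ^ 2 from rfl, ← pow_mul, mul_comm, pow_mul]
    exact Nat.pow_le_pow_left Nat.lt_two_pow_self.le 2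
  have h6 : (6 * n) ^ q ≤ 8 ^ n * n ^ q := by
    rw [mul_pow]
    exact Nat.mul_le_mul_right _ ((Nat.pow_le_pow_left (by norm_num) q).trans
      (Nat.pow_le_pow_right (by norm_num) (by omega)))
  have h15 : 15 ≤ 2 ^ n := le_trans (by norm_num) (Nat.pow_le_pow_right two_pos hn4)
  have hbig : 2 ^ (24 * n) ≤ n ^ r := calc
    2 ^ (24 * n) ≤ 2 ^ (288 * r) := Nat.pow_le_pow_right two_pos (by omega)
    _ = (16 ^ 72) ^ r := by
      rw [show 16 = 2 ^ 4 from rfl, ← pow_mul, ← pow_mul]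
      ring_nf
    _ ≤ n ^ r := Nat.pow_le_pow_left hn r
  calc 5 * (2 ^ (14 * n) * (6 * n) ^ q) * (6 * n ^ 2 * 16 ^ n)
      ≤ 5 * (2 ^ (14 * n) * (8 ^ n * n ^ q)) * (6 * 4 ^ n * 16 ^ n) := by gcongr
    _ = 2 * (15 * 2 ^ (23 * n) * n ^ q) := by
      rw [show 8 = 2 ^ 3 from rfl, show 4 = 2 ^ 2 from rfl, show 16 = 2 ^ 4 from rfl,
        ← pow_mul, ← pow_mul, ← pow_mul]
      ring
    _ ≤ 2 * (2 ^ n * 2 ^ (23 * n) * n ^ q) := by gcongr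
    _ = 2 * (2 ^ (24 * n) * n ^ q) := by rw [← pow_add]; ring_nf
    _ ≤ 2 * (n ^ r * n ^ q) := by gcongr
    _ = 2 * n ^ n := by rw [← pow_add, add_comm r, ← hr]

lemma two_pow_mul_pow_le_card_bridgedSet {n : ℕ} (hn : 16 ^ 72 ≤ n) :
    5 * (2 ^ (14 * n) * (6 * n) ^ (11 * n / 12)) ≤ 2 * Nat.card (bridgedSet n) := by
  have hpos : 0 < n := lt_of_lt_of_le (by positivity) hn
  refine Nat.le_of_mul_le_mul_right ?_ (show 0 < 6 * n ^ 2 * 16 ^ n by positivity)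
  refine (two_pow_mul_pow_le_pow_self hn).trans ?_
  obtain ⟨k, rfl⟩ := Nat.exists_eq_succ_of_ne_zero hpos.ne'
  rw [Nat.succ_eq_add_one]
  calc 2 * (k + 1) ^ (k + 1) ≤ 2 * ((k + 1).factorial * 4 ^ (k + 1)) :=
        Nat.mul_le_mul_left _ (pow_self_le_factorial_mul _)
    _ = 2 * ((k + 1) * k.factorial * 4 ^ (k + 1)) := by rw [Nat.factorial_succ]
    _ ≤ 2 * ((k + 1) * (Nat.card (bridgedSet (k + 1)) * (6 * (k + 1)) * 4 ^ (k + 1))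
          * 4 ^ (k + 1)) := by
      gcongr
      exact factorial_le_card_bridgedSet k
    _ = _ := by
      rw [show 16 = 4 * 4 from rfl, mul_pow 4 4]
      ring

/-- Asymptotically, bridged cubic graphs outnumber bridgeless ones. -/
lemma card_compl_bridgedSet_le {n : ℕ} (hn : 16 ^ 72 ≤ n) :
    Nat.card ((bridgedSet n)ᶜ : Set (GammaV n)) ≤ Nat.card (bridgedSet n) := by
  have h1 := five_mul_card_le (n := n) (le_trans (by norm_num) hn)
  have h2 : (5 * (2 ^ (14 * n) * (6 * n) ^ (11 * n / 12)) : ℝ) ≤ 2 * Nat.card (bridgedSet n) := by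
    exact_mod_cast two_pow_mul_pow_le_card_bridgedSet hn
  exact_mod_cast (by linarith :
    (Nat.card ((bridgedSet n)ᶜ : Set (GammaV n)) : ℝ) ≤ Nat.card (bridgedSet n))

end Asymptotics

/-- Provided `d(B_n) ≥ d(V(Γ_n) ∖ B_n)`, the outer conductance of the set of
bridged classes satisfies `φ_out(B_n) ≤ |B_n| / (3n |V(Γ_n) ∖ B_n|)`; consequently
`φ_out(Γ_n)` is bounded by the same quantity for all sufficiently large `n`. -/
theorem phiOut_bridged_bound :
    (∀ n : ℕ, 1 ≤ n →
      dOut n ((bridgedSet n)ᶜ) ≤ dOut n (bridgedSet n) →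
      phiOutSet n (bridgedSet n)
        ≤ (Nat.card (bridgedSet n) : ℝ)
            / (3 * n * (Nat.card ((bridgedSet n)ᶜ : Set (GammaV n)) : ℝ))) ∧
    ∃ N : ℕ, ∀ n, N ≤ n →
      phiOut n ≤ (Nat.card (bridgedSet n) : ℝ)
            / (3 * n * (Nat.card ((bridgedSet n)ᶜ : Set (GammaV n)) : ℝ)) := by
  exact ⟨fun n hn h => phiOutSet_bridgedSet_le n hn h, 16 ^ 72, fun n hn =>
    phiOut_le_of_card_le n (le_trans (by norm_num) hn) (card_compl_bridgedSet_le hn)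
      (bridgedSet_compl_nonempty n)⟩
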